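/- For every integer r with 1 ≤ r ≤ 4, the Ramsey number R(𝒫₄;r) equals r + 6. -/

import Mathlib

open Finset

/-- Four edges form a 3-uniform minimal 4-path: `aᵢ ∩ aⱼ ≠ ∅ ↔ |i - j| ≤ 1`. -/
def IsMinPath4 {α : Type*} [DecidableEq α] (a₀ a₁ a₂ a₃ : Finset α) : Prop :=
  (a₀ ∩ a₁).Nonempty ∧ (a₁ ∩ a₂).Nonempty ∧ (a₂ ∩ a₃).Nonempty ∧
    a₀ ∩ a₂ = ∅ ∧ a₀ ∩ a₃ = ∅ ∧ a₁ ∩ a₃ = ∅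

/-- The `r`-coloring `c` of the edges of the complete 3-graph on `Fin n`
yields a monochromatic minimal 4-path. -/
def HasMonoP4 {n r : ℕ} (c : Finset (Fin n) → Fin r) : Prop :=
  ∃ a₀ a₁ a₂ a₃ : Finset (Fin n),
    a₀.card = 3 ∧ a₁.card = 3 ∧ a₂.card = 3 ∧ a₃.card = 3 ∧
    IsMinPath4 a₀ a₁ a₂ a₃ ∧
    c a₀ = c a₁ ∧ c a₁ = c a₂ ∧ c a₂ = c a₃

set_option linter.unusedSectionVars false
namespace RP4

/-- Seinsche: a finite graph without induced `P₄` on at least two vertices, or its complement,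
is disconnected. -/
theorem cograph_aux {β : Type*} [DecidableEq β] (adj : β → β → Prop)
    (hs : ∀ x y, adj x y → adj y x) (v : β) (S : Finset β) (hv : v ∉ S)
    (hP : ∀ a ∈ insert v S, ∀ b ∈ insert v S, ∀ c ∈ insert v S, ∀ d ∈ insert v S,
      adj a b → adj b c → adj c d → ¬ adj a c → ¬ adj a d → ¬ adj b d → False)
    (A B : Finset β) (hA : A.Nonempty) (hB : B.Nonempty) (hd : Disjoint A B) (hu : A ∪ B = S)
    (hc : ∀ a ∈ A, ∀ b ∈ B, ¬ adj a b) :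
    ∃ A B : Finset β, A.Nonempty ∧ B.Nonempty ∧ Disjoint A B ∧ A ∪ B = insert v S ∧
      ((∀ a ∈ A, ∀ b ∈ B, adj a b) ∨ (∀ a ∈ A, ∀ b ∈ B, ¬ adj a b)) := by
  classical
  have hSne : S.Nonempty := by rw [← hu]; exact hA.mono subset_union_left
  by_cases hall : ∀ y ∈ S, adj v y
  · refine ⟨{v}, S, singleton_nonempty v, hSne, by simpa using hv, (insert_eq v S).symm, Or.inl ?_⟩
    intro a ha b hb
    rw [mem_singleton.1 ha]; exact hall b hb
  push Not at hall
  obtain ⟨y, hyS, hvy⟩ := hall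
  -- minimal closed set
  let F := S.powerset.filter (fun T => y ∈ T ∧ ∀ a ∈ T, ∀ b ∈ S \ T, ¬ adj a b)
  have key : ∃ T0 ∈ F, T0 ≠ S := by
    have hyAB : y ∈ A ∪ B := hu ▸ hyS
    have hBA : S \ A = B := by rw [← hu, union_sdiff_left]; exact sdiff_eq_self_of_disjoint hd.symm
    have hAB : S \ B = A := by rw [← hu, union_sdiff_right]; exact sdiff_eq_self_of_disjoint hd
    rcases mem_union.1 hyAB with h | h
    · refine ⟨A, ?_, ?_⟩
      · simp only [F, mem_filter, mem_powerset]
        refine ⟨hu ▸ subset_union_left, h, ?_⟩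
        rw [hBA]; exact hc
      · rintro rfl
        simp at hBA
        exact hB.ne_empty hBA.symm
    · refine ⟨B, ?_, ?_⟩
      · simp only [F, mem_filter, mem_powerset]
        refine ⟨hu ▸ subset_union_right, h, ?_⟩
        rw [hAB]; exact fun a ha b hb h => hc b hb a ha (hs _ _ h)
      · rintro rfl
        simp at hAB
        exact hA.ne_empty hAB.symm
  obtain ⟨T0, hT0, hT0S⟩ := key
  obtain ⟨T, hTF, hTmin⟩ := Finset.exists_min_image F Finset.card ⟨T0, hT0⟩
  have hT0' := hT0
  simp only [F, mem_filter, mem_powerset] at hTF hT0'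
  obtain ⟨hTS, hyT, hTc⟩ := hTF
  have hTne : T ≠ S := by
    rintro rfl
    have := hTmin T0 hT0
    exact hT0S (eq_of_subset_of_card_le hT0'.1 this)
  have hUne : (S \ T).Nonempty := by
    rw [sdiff_nonempty]; intro h; exact hTne (hTS.antisymm h)
  have hvT : v ∉ T := fun h => hv (hTS h)
  by_cases h1 : ∀ x ∈ T, ¬ adj v x
  · refine ⟨T, insert v (S \ T), ⟨y, hyT⟩, insert_nonempty _ _, ?_, ?_, Or.inr ?_⟩
    · rw [disjoint_insert_right]; exact ⟨hvT, disjoint_sdiff⟩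
    · rw [union_insert, union_sdiff_of_subset hTS]
    · intro a ha b hb
      rcases mem_insert.1 hb with rfl | hb
      · exact fun h => h1 a ha (hs _ _ h)
      · exact hTc a ha b hb
  by_cases h2 : ∀ x ∈ S \ T, ¬ adj v x
  · refine ⟨S \ T, insert v T, hUne, insert_nonempty _ _, ?_, ?_, Or.inr ?_⟩
    · rw [disjoint_insert_right]; exact ⟨fun h => hv (mem_sdiff.1 h).1, sdiff_disjoint⟩
    · rw [union_insert, sdiff_union_of_subset hTS]
    · intro a ha b hb
      rcases mem_insert.1 hb with rfl | hb
      · exact fun h => h2 a ha (hs _ _ h)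
      · exact fun h => hTc b hb a ha (hs _ _ h)
  push Not at h1 h2
  obtain ⟨z, hz, hvz⟩ := h2
  exfalso
  have h3 : ∃ x ∈ T, ∃ y ∈ T, adj v x ∧ ¬ adj v y ∧ adj x y := by
    by_contra hcon
    push Not at hcon
    obtain ⟨x, hx, hvx⟩ := h1
    have : T.filter (fun t => ¬ adj v t) ∈ F := by
      simp only [F, mem_filter, mem_powerset]
      refine ⟨(filter_subset _ _).trans hTS, ⟨hyT, hvy⟩, ?_⟩
      rintro a ⟨haT, hva⟩ b hb hab
      rw [mem_sdiff, mem_filter] at hb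
      by_cases hbT : b ∈ T
      · have hvb : adj v b := by
          by_contra h; exact hb.2 ⟨hbT, h⟩
        exact hcon b hbT a haT hvb hva (hs _ _ hab)
      · exact hTc a haT b (mem_sdiff.2 ⟨hb.1, hbT⟩) hab
    have h4 := hTmin _ this
    have h5 := eq_of_subset_of_card_le (filter_subset _ _) h4
    have : x ∈ T.filter (fun t => ¬ adj v t) := by rw [h5]; exact hx
    exact (mem_filter.1 this).2 hvx
  obtain ⟨x, hx, w, hw, hvx, hvw, hxw⟩ := h3
  have hzS := (mem_sdiff.1 hz).1
  exact hP z (mem_insert_of_mem hzS) v (mem_insert_self _ _) x (mem_insert_of_mem (hTS hx)) w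
    (mem_insert_of_mem (hTS hw)) (hs _ _ hvz) hvx hxw (fun h => hTc x hx z hz (hs _ _ h))
    (fun h => hTc w hw z hz (hs _ _ h)) hvw

theorem cograph {β : Type*} [DecidableEq β] (adj : β → β → Prop)
    (hs : ∀ x y, adj x y → adj y x) (S : Finset β) 
    (hP : ∀ a ∈ S, ∀ b ∈ S, ∀ c ∈ S, ∀ d ∈ S,
      adj a b → adj b c → adj c d → ¬ adj a c → ¬ adj a d → ¬ adj b d → False)
    (h2 : 2 ≤ S.card) :
    ∃ A B : Finset β, A.Nonempty ∧ B.Nonempty ∧ Disjoint A B ∧ A ∪ B = S ∧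
      ((∀ a ∈ A, ∀ b ∈ B, adj a b) ∨ (∀ a ∈ A, ∀ b ∈ B, ¬ adj a b)) := by
  classical
  induction S using Finset.induction_on with
  | empty => simp at h2
  | insert v S hv ih =>
    by_cases hS : 2 ≤ S.card
    · obtain ⟨A, B, hA, hB, hd, hu, h | h⟩ := ih (fun a ha b hb c hc d hd =>
        hP a (mem_insert_of_mem ha) b (mem_insert_of_mem hb) c (mem_insert_of_mem hc) d
          (mem_insert_of_mem hd)) hS
      · obtain ⟨A', B', hA', hB', hd', hu', h'⟩ := cograph_aux (fun x y => ¬ adj x y)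
          (fun x y h h' => h (hs _ _ h')) v S hv
          (fun a ha b hb c hc d hd h1 h2 h3 h4 h5 h6 => by
            simp only [not_not] at h4 h5 h6
            exact hP b hb d hd a ha c hc h6 (hs _ _ h5) h4 (fun h => h1 (hs _ _ h)) h2
              (fun h => h3 (hs _ _ h)))
          A B hA hB hd hu (fun a ha b hb => not_not.2 (h a ha b hb))
        refine ⟨A', B', hA', hB', hd', hu', ?_⟩
        simp only [not_not] at h'
        exact h'.symm
      · exact cograph_aux adj hs v S hv hP A B hA hB hd hu h
    · have hc : S.card = 1 := by
        rw [card_insert_of_notMem hv] at h2; omega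
      obtain ⟨w, rfl⟩ := card_eq_one.1 hc
      refine ⟨{v}, {w}, singleton_nonempty _, singleton_nonempty _, by simpa using hv, rfl, ?_⟩
      simp only [mem_singleton, forall_eq]
      exact em _

variable {α : Type*} [DecidableEq α]

def NoP4 (H : Finset (Finset α)) : Prop :=
  ∀ a ∈ H, ∀ b ∈ H, ∀ c ∈ H, ∀ d ∈ H, ¬ Disjoint a b → ¬ Disjoint b c → ¬ Disjoint c d →
    Disjoint a c → Disjoint a d → Disjoint b d → False

theorem NoP4.mono {H G : Finset (Finset α)} (h : NoP4 H) (hG : G ⊆ H) : NoP4 G :=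
  fun a ha b hb c hc d hd => h a (hG ha) b (hG hb) c (hG hc) d (hG hd)

/-- structure of a family with two disjoint members -/
theorem structure_split {H : Finset (Finset α)} (h : NoP4 H) {e f : Finset α} (he : e ∈ H)
    (hf : f ∈ H) (hef : Disjoint e f) (hne : e ≠ f) :
    ∃ A B R : Finset (Finset α), A.Nonempty ∧ B.Nonempty ∧ H = A ∪ B ∪ R ∧
      A.card + B.card + R.card = H.card ∧
      (∀ a ∈ A, ∀ b ∈ B, Disjoint a b) ∧ (∀ a ∈ A, ∀ r ∈ R, ¬ Disjoint a r) ∧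
      (∀ b ∈ B, ∀ r ∈ R, ¬ Disjoint b r) := by
  classical
  let F := H.powerset.filter (fun C => e ∈ C ∧ f ∈ C ∧ ∀ a ∈ C, ∀ b ∈ H \ C, ¬ Disjoint a b)
  have hHF : H ∈ F := by
    simp only [F, mem_filter, mem_powerset, sdiff_self]
    exact ⟨Subset.refl _, he, hf, fun _ _ b hb => absurd hb (notMem_empty b)⟩
  obtain ⟨C, hCF, hmin⟩ := Finset.exists_min_image F Finset.card ⟨H, hHF⟩
  simp only [F, mem_filter, mem_powerset] at hCF
  obtain ⟨hCH, heC, hfC, hCc⟩ := hCF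
  have h2 : 2 ≤ C.card := by
    have : ({e, f} : Finset (Finset α)) ⊆ C := by
      intro x hx; simp at hx; rcases hx with rfl | rfl <;> assumption
    calc 2 = ({e, f} : Finset (Finset α)).card := (card_pair hne).symm
      _ ≤ _ := card_le_card this
  obtain ⟨A, B, hA, hB, hd, hu, h' | h'⟩ := cograph (fun a b : Finset α => Disjoint a b)
    (fun x y h => h.symm) C (fun a ha b hb c hc d hd h1 h2 h3 h4 h5 h6 =>
      h b (hCH hb) d (hCH hd) a (hCH ha) c (hCH hc) h6 (fun h => h5 h.symm) h4 h1.symm h2 h3.symm) h2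
  · refine ⟨A, B, H \ C, hA, hB, ?_, ?_, h', ?_, ?_⟩
    · rw [hu, union_sdiff_of_subset hCH]
    · rw [← card_union_of_disjoint hd, hu, add_comm, card_sdiff_add_card_eq_card hCH]
    · exact fun a ha r hr => hCc a (hu ▸ mem_union_left _ ha) r hr
    · exact fun a ha r hr => hCc a (hu ▸ mem_union_right _ ha) r hr
  · exfalso
    have aux : ∀ A B : Finset (Finset α), B.Nonempty → Disjoint A B → A ∪ B = C →
        (∀ a ∈ A, ∀ b ∈ B, ¬ Disjoint a b) → e ∈ A → f ∈ A → False := by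
      intro A B hB hd hu h' heA hfA
      have : A ∈ F := by
        simp only [F, mem_filter, mem_powerset]
        refine ⟨(hu ▸ subset_union_left).trans hCH, heA, hfA, ?_⟩
        intro a ha b hb
        rw [mem_sdiff] at hb
        by_cases hbB : b ∈ B
        · exact h' a ha b hbB
        · refine hCc a (hu ▸ mem_union_left _ ha) b (mem_sdiff.2 ⟨hb.1, ?_⟩)
          rw [← hu, mem_union]; tauto
      have h3 := hmin A this
      rw [← hu, card_union_of_disjoint hd] at h3
      have := hB.card_pos
      omega
    have hfAB : f ∈ A ∪ B := hu ▸ hfC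
    have heAB : e ∈ A ∪ B := hu ▸ heC
    rcases mem_union.1 heAB with h1 | h1 <;> rcases mem_union.1 hfAB with h2 | h2
    · exact aux A B hB hd hu h' h1 h2
    · exact h' e h1 f h2 hef
    · exact h' f h2 e h1 hef.symm
    · exact aux B A hA hd.symm (by rw [union_comm, hu]) (fun a ha b hb h => h' b hb a ha h.symm) h1 h2

end RP4

set_option linter.unusedSectionVars false
namespace RP4
variable {α : Type*} [DecidableEq α]

theorem card_le_list {β : Type*} [DecidableEq β] {F : Finset β} (L : List (Finset β))
    (h : ∀ t ∈ F, ∃ G ∈ L, t ∈ G) : F.card ≤ (L.map Finset.card).sum := by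
  induction L generalizing F with
  | nil =>
    have : F = ∅ := eq_empty_of_forall_notMem fun t ht => by simpa using h t ht
    simp [this]
  | cons G L ih =>
    have h1 := ih (F := F \ G) (fun t ht => by
      obtain ⟨G', hG', ht'⟩ := h t (mem_sdiff.1 ht).1
      rcases List.mem_cons.1 hG' with rfl | h'
      · exact absurd ht' (mem_sdiff.1 ht).2
      · exact ⟨G', h', ht'⟩)
    have h2 := card_sdiff_add_card_inter F G
    have h3 : (F ∩ G).card ≤ G.card := card_le_card inter_subset_right
    simp only [List.map_cons, List.sum_cons]
    omega

/-- a 3-graph on `V` -/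
def Tri (V : Finset α) (H : Finset (Finset α)) : Prop := ∀ t ∈ H, t ⊆ V ∧ t.card = 3

theorem Tri.mono {V : Finset α} {H G : Finset (Finset α)} (h : Tri V H) (hG : G ⊆ H) : Tri V G :=
  fun t ht => h t (hG ht)

theorem triple_of_pair {t : Finset α} (ht : t.card = 3) {a b : α} (ha : a ∈ t) (hb : b ∈ t)
    (hab : a ≠ b) : ∃ c, c ≠ a ∧ c ≠ b ∧ t = {a, b, c} := by
  have h1 : ((t.erase a).erase b).card = 1 := by
    rw [card_erase_of_mem (mem_erase.2 ⟨hab.symm, hb⟩), card_erase_of_mem ha, ht]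
  obtain ⟨c, hc⟩ := card_eq_one.1 h1
  have hcm : c ∈ (t.erase a).erase b := by rw [hc]; simp
  simp only [mem_erase] at hcm
  refine ⟨c, hcm.2.1, hcm.1, ?_⟩
  rw [← insert_erase ha, ← insert_erase (mem_erase.2 ⟨hab.symm, hb⟩), hc]

theorem triple_of_one {t : Finset α} (ht : t.card = 3) {a : α} (ha : a ∈ t) :
    ∃ b c, b ≠ a ∧ c ≠ a ∧ b ≠ c ∧ t = {a, b, c} := by
  have h1 : (t.erase a).card = 2 := by rw [card_erase_of_mem ha, ht]
  obtain ⟨b, c, hbc, h⟩ := card_eq_two.1 h1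
  have hb : b ∈ t.erase a := by rw [h]; simp
  have hc : c ∈ t.erase a := by rw [h]; simp
  exact ⟨b, c, (mem_erase.1 hb).1, (mem_erase.1 hc).1, hbc, by rw [← insert_erase ha, h]⟩

theorem pair_of_one {t : Finset α} (ht : t.card = 2) {a : α} (ha : a ∈ t) :
    ∃ b, b ≠ a ∧ t = {a, b} := by
  have h1 : (t.erase a).card = 1 := by rw [card_erase_of_mem ha, ht]
  obtain ⟨b, h⟩ := card_eq_one.1 h1
  have hb : b ∈ t.erase a := by rw [h]; simp
  exact ⟨b, (mem_erase.1 hb).1, by rw [← insert_erase ha, h]⟩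

/-- families of triples through a pair -/
theorem card_pair {F : Finset (Finset α)} {S : Finset α} {a b : α} (hab : a ≠ b)
    (h : ∀ t ∈ F, t.card = 3 ∧ a ∈ t ∧ b ∈ t ∧ t ⊆ insert a (insert b S)) : F.card ≤ S.card := by
  have : F ⊆ S.image (fun x => {a, b, x}) := by
    intro t ht
    obtain ⟨h1, h2, h3, h4⟩ := h t ht
    obtain ⟨c, hca, hcb, rfl⟩ := triple_of_pair h1 h2 h3 hab
    have := h4 (show c ∈ ({a, b, c} : Finset α) by simp)
    simp only [mem_insert] at this
    exact mem_image.2 ⟨c, by tauto, rfl⟩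
  exact (card_le_card this).trans card_image_le

/-- families of triples through a pair, precise version -/
theorem card_pair' {F H : Finset (Finset α)} {S : Finset α} {a b : α} (hab : a ≠ b)
    (h : ∀ t ∈ F, t ∈ H ∧ t.card = 3 ∧ a ∈ t ∧ b ∈ t ∧ t ⊆ insert a (insert b S)) :
    F.card ≤ (S.filter fun x => ({a, b, x} : Finset α) ∈ H).card := by
  have : F ⊆ (S.filter fun x => ({a, b, x} : Finset α) ∈ H).image (fun x => {a, b, x}) := by
    intro t ht
    obtain ⟨h0, h1, h2, h3, h4⟩ := h t ht
    obtain ⟨c, hca, hcb, rfl⟩ := triple_of_pair h1 h2 h3 hab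
    have := h4 (show c ∈ ({a, b, c} : Finset α) by simp)
    simp only [mem_insert] at this
    exact mem_image.2 ⟨c, mem_filter.2 ⟨by tauto, h0⟩, rfl⟩
  exact (card_le_card this).trans card_image_le

theorem card_star {F : Finset (Finset α)} {D : Finset α} {y : α}
    (h : ∀ t ∈ F, t.card = 3 ∧ y ∈ t ∧ t ⊆ insert y D) : F.card ≤ D.card.choose 2 := by
  rw [← card_powersetCard]
  refine card_le_card_of_injOn (fun t => t.erase y) ?_ ?_
  · intro t ht
    obtain ⟨h1, h2, h3⟩ := h t ht
    simp only [mem_coe, mem_powersetCard]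
    refine ⟨?_, by rw [card_erase_of_mem h2, h1]⟩
    intro x hx
    have := h3 (mem_of_mem_erase hx)
    rcases mem_insert.1 this with rfl | h
    · simp at hx
    · exact h
  · intro t ht s hs hts
    have := congrArg (insert y) hts
    simpa [insert_erase (h t ht).2.1, insert_erase (h s hs).2.1] using this

theorem card_triples {F : Finset (Finset α)} {D : Finset α} (h : Tri D F) :
    F.card ≤ D.card.choose 3 := by
  rw [← card_powersetCard]
  exact card_le_card fun t ht => mem_powersetCard.2 (h t ht)

/-- pairs hitting a given pair -/
theorem card_hit1 {G : Finset (Finset α)} {S : Finset α} {u v : α} (hu : u ∈ S) (hv : v ∈ S)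
    (huv : u ≠ v) (h : ∀ g ∈ G, g.card = 2 ∧ g ⊆ S ∧ (u ∈ g ∨ v ∈ g)) :
    G.card + 3 ≤ 2 * S.card := by
  have h1 : G ⊆ (S.erase u).image (fun x => {u, x}) ∪
      ((S.erase u).erase v).image (fun x => {v, x}) := by
    intro g hg
    obtain ⟨h1, h2, h3⟩ := h g hg
    rw [mem_union, mem_image, mem_image]
    by_cases hug : u ∈ g
    · obtain ⟨b, hb, rfl⟩ := pair_of_one h1 hug
      exact Or.inl ⟨b, mem_erase.2 ⟨hb, h2 (by simp)⟩, rfl⟩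
    · obtain ⟨b, hb, rfl⟩ := pair_of_one h1 (h3.resolve_left hug)
      refine Or.inr ⟨b, mem_erase.2 ⟨hb, mem_erase.2 ⟨?_, h2 (by simp)⟩⟩, rfl⟩
      rintro rfl; simp at hug
  have h2 := (card_le_card h1).trans (card_union_le _ _)
  have h3 := (card_image_le (s := S.erase u) (f := fun x => ({u, x} : Finset α)))
  have h4 := (card_image_le (s := (S.erase u).erase v) (f := fun x => ({v, x} : Finset α)))
  have h5 := card_erase_of_mem (mem_erase.2 ⟨huv.symm, hv⟩)
  have h6 := card_erase_of_mem hu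
  have h7 : 2 ≤ S.card := by
    rw [← Finset.card_pair huv]; apply card_le_card; intro x; simp; rintro (rfl | rfl) <;> assumption
  omega

/-- pairs hitting two distinct pairs -/
theorem card_hit2 {G : Finset (Finset α)} {S : Finset α} {g1 g2 : Finset α} (h1 : g1 ⊆ S)
    (h2 : g2 ⊆ S) (c1 : g1.card = 2) (c2 : g2.card = 2) (hne : g1 ≠ g2)
    (h : ∀ g ∈ G, g.card = 2 ∧ g ⊆ S ∧ ¬ Disjoint g g1 ∧ ¬ Disjoint g g2) :
    G.card ≤ S.card := by
  by_cases hd : Disjoint g1 g2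
  · have h4 : 4 ≤ S.card := by
      have := card_le_card (union_subset h1 h2)
      rw [card_union_of_disjoint hd] at this; omega
    have : G ⊆ (g1 ×ˢ g2).image (fun p => {p.1, p.2}) := by
      intro g hg
      obtain ⟨a1, a2, a3, a4⟩ := h g hg
      obtain ⟨x, hx, hx1⟩ := not_disjoint_iff.1 a3
      obtain ⟨y, hy, hy1⟩ := not_disjoint_iff.1 a4
      have hxy : x ≠ y := fun e => (disjoint_left.1 hd hx1) (e ▸ hy1)
      refine mem_image.2 ⟨(x, y), mem_product.2 ⟨hx1, hy1⟩, ?_⟩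
      apply eq_of_subset_of_card_le
      · intro z; simp; rintro (rfl | rfl) <;> assumption
      · rw [a1]; simp [Finset.card_pair hxy]
    have h5 := (card_le_card this).trans card_image_le
    rw [card_product, c1, c2] at h5
    omega
  · obtain ⟨u, hu1, hu2⟩ := not_disjoint_iff.1 hd
    obtain ⟨v, hv, rfl⟩ := pair_of_one c1 hu1
    obtain ⟨w, hw, rfl⟩ := pair_of_one c2 hu2
    have hvw : v ≠ w := by rintro rfl; exact hne rfl
    have : G ⊆ insert {v, w} ((S.erase u).image (fun x => {u, x})) := by
      intro g hg
      obtain ⟨a1, a2, a3, a4⟩ := h g hg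
      rw [mem_insert, mem_image]
      by_cases hug : u ∈ g
      · obtain ⟨b, hb, rfl⟩ := pair_of_one a1 hug
        exact Or.inr ⟨b, mem_erase.2 ⟨hb, a2 (by simp)⟩, rfl⟩
      · left
        have hvg : v ∈ g := by
          simp [hug] at a3; exact a3
        have hwg : w ∈ g := by
          simp [hug] at a4; exact a4
        symm
        apply eq_of_subset_of_card_le
        · intro z; simp; rintro (rfl | rfl) <;> assumption
        · rw [a1, Finset.card_pair hvw]
    have h5 := (card_le_card this).trans (card_insert_le _ _)
    have h3 := (card_image_le (s := S.erase u) (f := fun x => ({u, x} : Finset α)))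
    have h6 := card_erase_of_mem (h1 (show u ∈ ({u, v} : Finset α) by simp))
    have h7 : 0 < S.card := card_pos.2 ⟨u, h1 (by simp)⟩
    omega

/-- basic four-path -/
theorem sunflower {H : Finset (Finset α)} (h : NoP4 H) {a b c d i j k : α}
    (h1 : a ≠ c) (h2 : a ≠ d) (h3 : b ≠ c) (h4 : b ≠ d)
    (hi : i ≠ a ∧ i ≠ b ∧ i ≠ c ∧ i ≠ d) (hj : j ≠ a ∧ j ≠ b ∧ j ≠ c ∧ j ≠ d)
    (hk : k ≠ a ∧ k ≠ b ∧ k ≠ c ∧ k ≠ d) (hij : i ≠ j) (hik : i ≠ k) (hjk : j ≠ k)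
    (e1 : ({a, b, i} : Finset α) ∈ H) (e2 : ({a, b, k} : Finset α) ∈ H)
    (e3 : ({c, d, i} : Finset α) ∈ H) (e4 : ({c, d, j} : Finset α) ∈ H) : False := by
  refine h _ e4 _ e3 _ e1 _ e2 ?_ ?_ ?_ ?_ ?_ ?_
  · simp
  · simp
  · simp
  · simp; grind
  · simp; grind
  · simp; grind

theorem sunflower_num {H : Finset (Finset α)} (h : NoP4 H) {a b c d : α} {X Y : Finset α}
    (h1 : a ≠ c) (h2 : a ≠ d) (h3 : b ≠ c) (h4 : b ≠ d)
    (hX : ∀ x ∈ X, (x ≠ a ∧ x ≠ b ∧ x ≠ c ∧ x ≠ d) ∧ ({a, b, x} : Finset α) ∈ H)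
    (hY : ∀ x ∈ Y, (x ≠ a ∧ x ≠ b ∧ x ≠ c ∧ x ≠ d) ∧ ({c, d, x} : Finset α) ∈ H) :
    Disjoint X Y ∨ X.card ≤ 1 ∨ Y.card ≤ 1 ∨ (X.card = 2 ∧ Y.card = 2) := by
  by_contra hcon
  push Not at hcon
  obtain ⟨hd, hx, hy, hxy⟩ := hcon
  obtain ⟨i, hiX, hiY⟩ := not_disjoint_iff.1 hd
  have : ∃ j ∈ Y, ∃ k ∈ X, i ≠ j ∧ i ≠ k ∧ j ≠ k := by
    by_cases h3 : 2 < X.card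
    · obtain ⟨j, hj, hji⟩ := exists_mem_ne hy i
      obtain ⟨k, hk⟩ : (((X.erase i).erase j)).Nonempty := by
        rw [← card_pos]
        have := pred_card_le_card_erase (s := X) (a := i)
        have := pred_card_le_card_erase (s := X.erase i) (a := j)
        omega
      simp only [mem_erase] at hk
      exact ⟨j, hj, k, hk.2.2, hji.symm, fun h => hk.2.1 h.symm, fun h => hk.1 h.symm⟩
    · obtain ⟨k, hk, hki⟩ := exists_mem_ne hx i
      obtain ⟨j, hj⟩ : (((Y.erase i).erase k)).Nonempty := by
        rw [← card_pos]
        have := pred_card_le_card_erase (s := Y) (a := i)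
        have := pred_card_le_card_erase (s := Y.erase i) (a := k)
        omega
      simp only [mem_erase] at hj
      exact ⟨j, hj.2.2, k, hk, fun h => hj.2.1 h.symm, hki.symm, hj.1⟩
  obtain ⟨j, hj, k, hk, hij, hik, hjk⟩ := this
  exact sunflower h h1 h2 h3 h4 (hX i hiX).1 (hY j hj).1 (hX k hk).1 hij hik hjk (hX i hiX).2
    (hX k hk).2 (hY i hiY).2 (hY j hj).2

theorem sunflower_card {H : Finset (Finset α)} (h : NoP4 H) {a b c d : α} {X Y S : Finset α}
    (h1 : a ≠ c) (h2 : a ≠ d) (h3 : b ≠ c) (h4 : b ≠ d) (hS : 3 ≤ S.card)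
    (hXS : X ⊆ S) (hYS : Y ⊆ S)
    (hX : ∀ x ∈ X, (x ≠ a ∧ x ≠ b ∧ x ≠ c ∧ x ≠ d) ∧ ({a, b, x} : Finset α) ∈ H)
    (hY : ∀ x ∈ Y, (x ≠ a ∧ x ≠ b ∧ x ≠ c ∧ x ≠ d) ∧ ({c, d, x} : Finset α) ∈ H) :
    X.card + Y.card ≤ S.card + 1 ∧ (X.card + Y.card = S.card + 1 → S.card ≤ 3 ∨ X.card ≤ 1 ∨ Y.card ≤ 1) := by
  have hx := card_le_card hXS
  have hy := card_le_card hYS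
  rcases sunflower_num h h1 h2 h3 h4 hX hY with h | h | h | h
  · have := card_le_card (union_subset hXS hYS)
    rw [card_union_of_disjoint h] at this; omega
  all_goals omega

end RP4

namespace RP4
variable {α : Type*} [DecidableEq α]

theorem link_card {F : Finset (Finset α)} {x : α} (h : ∀ t ∈ F, x ∈ t) :
    (F.image (fun t => t.erase x)).card = F.card := by
  apply card_image_of_injOn
  intro t ht s hs hts
  have := congrArg (insert x) hts
  simpa [insert_erase (h t ht), insert_erase (h s hs)] using this

/-- counting cross-intersecting links -/
theorem cross_link {F G : Finset (Finset α)} {S : Finset α} {x y : α} (hxy : x ≠ y)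
    (hx : x ∉ S) (hy : y ∉ S)
    (hF : ∀ t ∈ F, t.card = 3 ∧ x ∈ t ∧ t ⊆ insert x S)
    (hG : ∀ t ∈ G, t.card = 3 ∧ y ∈ t ∧ t ⊆ insert y S)
    (hc : ∀ t ∈ F, ∀ s ∈ G, ¬ Disjoint t s) (hne : F.Nonempty) :
    G.card + 3 ≤ 2 * S.card ∧ (2 ≤ F.card → G.card ≤ S.card) := by
  have lx : ∀ t ∈ F, (t.erase x).card = 2 ∧ t.erase x ⊆ S := by
    intro t ht
    obtain ⟨a, b, c⟩ := hF t ht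
    refine ⟨by rw [card_erase_of_mem b, a], fun z hz => ?_⟩
    have := c (mem_of_mem_erase hz)
    exact (mem_insert.1 this).resolve_left (ne_of_mem_erase hz)
  have ly : ∀ t ∈ G, (t.erase y).card = 2 ∧ t.erase y ⊆ S := by
    intro t ht
    obtain ⟨a, b, c⟩ := hG t ht
    refine ⟨by rw [card_erase_of_mem b, a], fun z hz => ?_⟩
    have := c (mem_of_mem_erase hz)
    exact (mem_insert.1 this).resolve_left (ne_of_mem_erase hz)
  have lc : ∀ t ∈ F, ∀ s ∈ G, ¬ Disjoint (s.erase y) (t.erase x) := by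
    intro t ht s hs
    obtain ⟨z, hz1, hz2⟩ := not_disjoint_iff.1 (hc t ht s hs)
    have hzx : z ≠ x := by
      rintro rfl
      have := (hG s hs).2.2 hz2
      simp [hxy, hx] at this
    have hzy : z ≠ y := by
      rintro rfl
      have := (hF t ht).2.2 hz1
      simp [hxy.symm, hy] at this
    exact not_disjoint_iff.2 ⟨z, mem_erase.2 ⟨hzy, hz2⟩, mem_erase.2 ⟨hzx, hz1⟩⟩
  rw [← link_card (fun t ht => (hG t ht).2.1)]
  constructor
  · obtain ⟨t, ht⟩ := hne
    obtain ⟨u, v, huv, he⟩ := card_eq_two.1 (lx t ht).1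
    have hu : u ∈ t.erase x := by rw [he]; simp
    have hv : v ∈ t.erase x := by rw [he]; simp
    apply card_hit1 ((lx t ht).2 hu) ((lx t ht).2 hv) huv
    intro g hg
    obtain ⟨s, hs, rfl⟩ := mem_image.1 hg
    refine ⟨(ly s hs).1, (ly s hs).2, ?_⟩
    have := lc t ht s hs
    rw [he] at this
    simp only [disjoint_insert_right, disjoint_singleton_right] at this
    tauto
  · intro h2
    obtain ⟨t, ht, t', ht', hne⟩ := one_lt_card.1 h2
    have : t.erase x ≠ t'.erase x := by
      intro h
      have := congrArg (insert x) h
      rw [insert_erase (hF t ht).2.1, insert_erase (hF t' ht').2.1] at this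
      exact hne this
    apply card_hit2 (lx t ht).2 (lx t' ht').2 (lx t ht).1 (lx t' ht').1 this
    intro g hg
    obtain ⟨s, hs, rfl⟩ := mem_image.1 hg
    exact ⟨(ly s hs).1, (ly s hs).2, lc t ht s hs, lc t' ht' s hs⟩

theorem inter_cover {V : Finset α} {H : Finset (Finset α)} (hT : Tri V H)
    (hi : ∀ s ∈ H, ∀ t ∈ H, ¬ Disjoint s t) (hn : ∀ v, ∃ t ∈ H, v ∉ t) {x y : α} (hxy : x ≠ y)
    (hx : x ∈ V) (hy : y ∈ V) (hV : 4 ≤ V.card) (hc : ∀ t ∈ H, x ∈ t ∨ y ∈ t) :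
    H.card + 6 ≤ 3 * V.card := by
  set S := (V.erase x).erase y with hS
  have hScard : S.card + 2 = V.card := by
    rw [hS, card_erase_of_mem (mem_erase.2 ⟨hxy.symm, hy⟩), card_erase_of_mem hx]; omega
  have hsub : ∀ t ∈ H, t ⊆ insert x (insert y S) := by
    intro t ht z hz
    have := (hT t ht).1 hz
    simp only [hS, mem_insert, mem_erase]; tauto
  have hxS : x ∉ S := by simp [hS]
  have hyS : y ∉ S := by simp [hS]
  set Hx := H.filter (fun t => y ∉ t) with hHx
  set Hy := H.filter (fun t => x ∉ t) with hHy
  set Hxy := H.filter (fun t => x ∈ t ∧ y ∈ t) with hHxy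
  have hcard : H.card ≤ Hx.card + Hy.card + Hxy.card := by
    have : H ⊆ Hx ∪ Hy ∪ Hxy := by
      intro t ht; simp only [hHx, hHy, hHxy, mem_union, mem_filter]; tauto
    have h1 := card_le_card this
    have h2 := card_union_le (Hx ∪ Hy) Hxy
    have h3 := card_union_le Hx Hy
    omega
  have h1 : Hxy.card ≤ S.card := by
    apply card_pair hxy
    intro t ht
    have := mem_filter.1 ht
    exact ⟨(hT t this.1).2, this.2.1, this.2.2, hsub t this.1⟩
  have hX : ∀ t ∈ Hx, t.card = 3 ∧ x ∈ t ∧ t ⊆ insert x S := by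
    intro t ht
    have h := mem_filter.1 ht
    refine ⟨(hT t h.1).2, (hc t h.1).resolve_right h.2, fun z hz => ?_⟩
    have := hsub t h.1 hz
    have hzy : z ≠ y := by rintro rfl; exact h.2 hz
    simp only [mem_insert] at this ⊢; tauto
  have hY : ∀ t ∈ Hy, t.card = 3 ∧ y ∈ t ∧ t ⊆ insert y S := by
    intro t ht
    have h := mem_filter.1 ht
    refine ⟨(hT t h.1).2, (hc t h.1).resolve_left h.2, fun z hz => ?_⟩
    have := hsub t h.1 hz
    have hzy : z ≠ x := by rintro rfl; exact h.2 hz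
    simp only [mem_insert] at this ⊢; tauto
  have neX : Hx.Nonempty := by
    obtain ⟨t, ht, h⟩ := hn y; exact ⟨t, mem_filter.2 ⟨ht, h⟩⟩
  have neY : Hy.Nonempty := by
    obtain ⟨t, ht, h⟩ := hn x; exact ⟨t, mem_filter.2 ⟨ht, h⟩⟩
  have a1 := cross_link hxy hxS hyS hX hY
    (fun t ht s hs => hi t (mem_filter.1 ht).1 s (mem_filter.1 hs).1) neX
  have a2 := cross_link hxy.symm hyS hxS hY hX
    (fun t ht s hs => hi t (mem_filter.1 ht).1 s (mem_filter.1 hs).1) neY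
  have := neX.card_pos
  have := neY.card_pos
  omega

theorem inter_nocover {V : Finset α} {H : Finset (Finset α)} (hT : Tri V H)
    (hi : ∀ s ∈ H, ∀ t ∈ H, ¬ Disjoint s t) 
    (hn : ∀ x y, ∃ t ∈ H, x ∉ t ∧ y ∉ t) : H.card ≤ 19 := by
  by_cases hH : H = ∅
  · simp [hH]
  obtain ⟨e, he⟩ := nonempty_iff_ne_empty.2 hH
  obtain ⟨a, b, c, hab, hac, hbc, rfl⟩ := card_eq_three.1 (hT e he).2
  -- edges meeting in exactly one given vertex
  have one : ∀ a b c : α, a ≠ b → a ≠ c → b ≠ c → ({a, b, c} : Finset α) ∈ H →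
      (H.filter (fun t => a ∈ t ∧ b ∉ t ∧ c ∉ t)).card ≤ 4 := by
    intro a b c hab hac hbc he
    have two : ∀ g ∈ H, (g \ {a, b, c}).card ≤ 2 := by
      intro g hg
      have h1 := card_sdiff_add_card_inter g {a, b, c}
      have h2 : 0 < (g ∩ {a, b, c}).card := by
        rw [card_pos]; exact not_disjoint_iff_nonempty_inter.1 (hi g hg _ he)
      have := (hT g hg).2
      omega
    choose G hG using hn
    set f := G a a
    have : H.filter (fun t => a ∈ t ∧ b ∉ t ∧ c ∉ t) ⊆
        (f \ {a, b, c}).biUnion (fun y => (G a y \ {a, b, c}).image (fun z => {a, y, z})) := by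
      intro t ht
      simp only [mem_filter] at ht
      obtain ⟨ht, hat, hbt, hct⟩ := ht
      have nin : ∀ z ∈ t, z ≠ a → z ∉ ({a, b, c} : Finset α) := by
        intro z hz hza; simp only [mem_insert, mem_singleton]
        rintro (rfl | rfl | rfl) <;> contradiction
      obtain ⟨y, hyt, hyf⟩ := not_disjoint_iff.1 (hi t ht f (hG a a).1)
      have hya : y ≠ a := by rintro rfl; exact (hG y y).2.1 hyf
      obtain ⟨z, hzt, hzg⟩ := not_disjoint_iff.1 (hi t ht (G a y) (hG a y).1)
      have hza : z ≠ a := by rintro rfl; exact (hG z y).2.1 hzg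
      have hzy : z ≠ y := by rintro rfl; exact (hG a z).2.2 hzg
      simp only [mem_biUnion, mem_image]
      refine ⟨y, mem_sdiff.2 ⟨hyf, nin y hyt hya⟩, z, mem_sdiff.2 ⟨hzg, nin z hzt hza⟩, ?_⟩
      obtain ⟨w, hw1, hw2, rfl⟩ := triple_of_pair (hT t ht).2 hat hyt hya.symm
      simp only [mem_insert, mem_singleton] at hzt
      rcases hzt with rfl | rfl | rfl
      · contradiction
      · contradiction
      · rfl
    refine (card_le_card this).trans (card_biUnion_le.trans ?_)
    calc _ ≤ ∑ y ∈ f \ {a, b, c}, 2 := sum_le_sum fun y _ => card_image_le.trans (two _ (hG a y).1)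
      _ = (f \ {a, b, c}).card * 2 := by simp
      _ ≤ 2 * 2 := Nat.mul_le_mul_right _ (two _ (hG a a).1)
  have pr : ∀ a b c : α, a ≠ b → a ≠ c → b ≠ c → ({a, b, c} : Finset α) ∈ H →
      (H.filter (fun t => a ∈ t ∧ b ∈ t ∧ c ∉ t)).card ≤ 2 := by
    intro a b c hab hac hbc he
    obtain ⟨g, hg, hga, hgb⟩ := hn a b
    have hgc : c ∈ g := by
      have := hi g hg _ he
      simp only [disjoint_insert_right, disjoint_singleton_right] at this; tauto
    have : (g.erase c).card = 2 := by rw [card_erase_of_mem hgc, (hT g hg).2]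
    rw [← this]
    apply card_pair hab
    intro t ht
    simp only [mem_filter] at ht
    obtain ⟨ht, h1, h2, h3⟩ := ht
    refine ⟨(hT t ht).2, h1, h2, ?_⟩
    obtain ⟨w, hw1, hw2, rfl⟩ := triple_of_pair (hT t ht).2 h1 h2 hab
    have := hi g hg _ ht
    simp only [disjoint_insert_right, disjoint_singleton_right] at this
    have hwg : w ∈ g := by tauto
    have hwc : w ≠ c := by rintro rfl; simp at h3
    intro z; simp only [mem_insert, mem_singleton, mem_erase]; 
    rintro (rfl | rfl | rfl) <;> tauto
  have hbac : ({b, a, c} : Finset α) ∈ H := by rwa [insert_comm]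
  have hcab : ({c, a, b} : Finset α) ∈ H := by
    rwa [insert_comm, pair_comm c b]
  have hacb : ({a, c, b} : Finset α) ∈ H := by rwa [pair_comm c b]
  have hbca : ({b, c, a} : Finset α) ∈ H := by rwa [pair_comm c a]
  have k1 := one a b c hab hac hbc he
  have k2 := one b a c hab.symm hbc hac hbac
  have k3 := one c a b hac.symm hbc.symm hab hcab
  have k4 := pr a b c hab hac hbc he
  have k5 := pr a c b hac hab hbc.symm hacb
  have k6 := pr b c a hbc hab.symm hac.symm hbca
  have key := card_le_list (F := H) [{{a, b, c}}, H.filter (fun t => a ∈ t ∧ b ∉ t ∧ c ∉ t),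
      H.filter (fun t => b ∈ t ∧ a ∉ t ∧ c ∉ t), H.filter (fun t => c ∈ t ∧ a ∉ t ∧ b ∉ t),
      H.filter (fun t => a ∈ t ∧ b ∈ t ∧ c ∉ t), H.filter (fun t => a ∈ t ∧ c ∈ t ∧ b ∉ t),
      H.filter (fun t => b ∈ t ∧ c ∈ t ∧ a ∉ t)] (by
    intro t ht
    have h1 := hi t ht _ he
    simp only [disjoint_insert_right, disjoint_singleton_right] at h1
    have h2 : a ∈ t → b ∈ t → c ∈ t → t = {a, b, c} := by
      intro h1 h2 h3
      symm
      apply eq_of_subset_of_card_le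
      · intro z; simp only [mem_insert, mem_singleton]; rintro (rfl | rfl | rfl) <;> assumption
      · rw [(hT t ht).2, (hT _ he).2]
    simp only [List.mem_cons, List.not_mem_nil, or_false, exists_eq_or_imp, exists_eq_left,
      mem_filter, mem_singleton, ht, true_and]
    by_cases ha : a ∈ t <;> by_cases hb : b ∈ t <;> by_cases hc : c ∈ t <;>
      simp_all)
  simp only [List.map_cons, List.map_nil, List.sum_cons, List.sum_nil, card_singleton] at key
  omega

theorem intersecting_bound {V : Finset α} {H : Finset (Finset α)} (hT : Tri V H)
    (hi : ∀ s ∈ H, ∀ t ∈ H, ¬ Disjoint s t) (hn : ∀ v, ∃ t ∈ H, v ∉ t) (hV : 8 ≤ V.card) :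
    H.card + 6 ≤ 3 * V.card ∨ H.card ≤ 19 := by
  by_cases h : ∀ x y, ∃ t ∈ H, x ∉ t ∧ y ∉ t
  · exact Or.inr (inter_nocover hT hi h)
  · left
    push Not at h
    obtain ⟨x, y, h⟩ := h
    have h' : ∀ t ∈ H, x ∈ t ∨ y ∈ t := fun t ht => by
      have := h t ht; tauto
    obtain ⟨t, ht, hxt⟩ := hn x
    obtain ⟨s, hs, hys⟩ := hn y
    have hyt := (h' t ht).resolve_left hxt
    have hxs := (h' s hs).resolve_right hys
    exact inter_cover hT hi hn (by rintro rfl; exact hxt hyt) ((hT s hs).1 hxs) ((hT t ht).1 hyt)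
      (by omega) h'
end RP4

namespace RP4
variable {α : Type*} [DecidableEq α]

/-- thirds of a pair -/
def th (R : Finset (Finset α)) (x y : α) (S : Finset α) : Finset α :=
  S.filter fun z => ({x, y, z} : Finset α) ∈ R

theorem mem_th {R : Finset (Finset α)} {x y z : α} {S : Finset α} :
    z ∈ th R x y S ↔ z ∈ S ∧ ({x, y, z} : Finset α) ∈ R := mem_filter

theorem th_card_le {R : Finset (Finset α)} {x y : α} {S : Finset α} :
    (th R x y S).card ≤ S.card := card_filter_le _ _

theorem th_union {R : Finset (Finset α)} {x y : α} {S T : Finset α} (h : Disjoint S T) :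
    (th R x y (S ∪ T)).card = (th R x y S).card + (th R x y T).card := by
  unfold th
  rw [filter_union, card_union_of_disjoint (disjoint_filter_filter h)]

theorem th_pairs {R : Finset (Finset α)} (h : NoP4 R) {a b c d : α} {W P : Finset α}
    (h1 : a ≠ c) (h2 : a ≠ d) (h3 : b ≠ c) (h4 : b ≠ d) (hWP : Disjoint W P)
    (hW : a ∉ W ∧ b ∉ W ∧ c ∉ W ∧ d ∉ W) (hP : a ∉ P ∧ b ∉ P ∧ c ∉ P ∧ d ∉ P) :
    ((th R a b W).card + (th R c d W).card ≤ W.card ∧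
      (th R a b P).card + (th R c d P).card ≤ P.card) ∨
    (th R a b W).card + (th R a b P).card ≤ 1 ∨ (th R c d W).card + (th R c d P).card ≤ 1 ∨
    ((th R a b W).card + (th R a b P).card = 2 ∧ (th R c d W).card + (th R c d P).card = 2) := by
  rw [← th_union hWP, ← th_union hWP]
  have hne : ∀ x ∈ W ∪ P, x ≠ a ∧ x ≠ b ∧ x ≠ c ∧ x ≠ d := by
    intro x hx
    refine ⟨?_, ?_, ?_, ?_⟩ <;> rintro rfl <;> rcases mem_union.1 hx with h | h <;> tauto
  rcases sunflower_num h h1 h2 h3 h4 (X := th R a b (W ∪ P)) (Y := th R c d (W ∪ P))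
    (fun x hx => ⟨hne x (mem_th.1 hx).1, (mem_th.1 hx).2⟩)
    (fun x hx => ⟨hne x (mem_th.1 hx).1, (mem_th.1 hx).2⟩) with hd | hd
  · left
    have aux : ∀ S ⊆ W ∪ P, (th R a b S).card + (th R c d S).card ≤ S.card := by
      intro S hS
      rw [← card_union_of_disjoint]
      · exact card_le_card (union_subset (filter_subset _ _) (filter_subset _ _))
      · exact hd.mono (filter_subset_filter _ hS) (filter_subset_filter _ hS)
    exact ⟨aux W subset_union_left, aux P subset_union_right⟩
  · exact Or.inr hd

theorem matching_bound {R : Finset (Finset α)} (h : NoP4 R) {a b c d p q : α} {W : Finset α}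
    (hd : [a, b, c, d, p, q].Nodup) (hW : ∀ x ∈ W, x ∉ [a, b, c, d, p, q]) (hc : 2 ≤ W.card) (hc4 : W.card ≤ 4) :
    2 * ((th R a b W).card + (th R c d W).card + (th R p q W).card) +
      ((th R a b {c, d, p, q}).card + (th R c d {a, b, p, q}).card + (th R p q {a, b, c, d}).card)
      ≤ 2 * W.card + 10 := by
  simp only [List.nodup_cons, List.mem_cons, List.not_mem_nil, or_false, not_or, not_false_eq_true,
    List.nodup_nil, and_true] at hd
  obtain ⟨⟨hab, hac, had, hap, haq⟩, ⟨hbc, hbd, hbp, hbq⟩, ⟨hcd, hcp, hcq⟩, ⟨hdp, hdq⟩, hpq⟩ := hd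
  have nW : ∀ x ∈ [a, b, c, d, p, q], x ∉ W := fun x hx hxW => hW x hxW hx
  simp only [List.mem_cons, List.not_mem_nil, or_false, forall_eq_or_imp, forall_eq] at nW
  obtain ⟨na, nb, nc, nd, np, nq⟩ := nW
  have dW : ∀ x y, x ∉ W → y ∉ W → Disjoint W {x, y} := by
    intro x y hx hy; simp [hx, hy]
  have un : ∀ x y s t : α, ({x, y, s, t} : Finset α) = {x, y} ∪ {s, t} := by
    intro x y s t; ext z; simp only [mem_insert, mem_singleton, mem_union, or_assoc]
  rw [un c d p q, un a b p q, un a b c d, th_union (by simp; grind), th_union (by simp; grind),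
    th_union (by simp; grind)]
  have k1 := th_pairs h hac had hbc hbd (dW p q np nq) ⟨na, nb, nc, nd⟩ (by simp; grind)
  have k2 := th_pairs h hap haq hbp hbq (dW c d nc nd) ⟨na, nb, np, nq⟩ (by simp; grind)
  have k3 := th_pairs h hcp hcq hdp hdq (dW a b na nb) ⟨nc, nd, np, nq⟩ (by simp; grind)
  have c2 : ∀ x y : α, ({x, y} : Finset α).card ≤ 2 := fun x y => card_le_two
  have t2 : ∀ x y u v : α, (th R x y {u, v}).card ≤ 2 := fun x y u v => th_card_le.trans (c2 _ _)
  have b1 := t2 a b c d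
  have b2 := t2 a b p q
  have b3 := t2 c d a b
  have b4 := t2 c d p q
  have b5 := t2 p q a b
  have b6 := t2 p q c d
  have w1 := th_card_le (R := R) (x := a) (y := b) (S := W)
  have w2 := th_card_le (R := R) (x := c) (y := d) (S := W)
  have w3 := th_card_le (R := R) (x := p) (y := q) (S := W)
  have e1 := c2 a b
  have e2 := c2 c d
  have e3 := c2 p q
  omega

set_option maxHeartbeats 2000000 in
theorem two_edges_bound {V : Finset α} {R : Finset (Finset α)} (h : NoP4 R) (hT : Tri V R)
    {e f : Finset α} (he : e ⊆ V) (hf : f ⊆ V) (ce : e.card = 3) (cf : f.card = 3)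
    (hef : Disjoint e f) (hRe : ∀ r ∈ R, ¬ Disjoint e r) (hRf : ∀ r ∈ R, ¬ Disjoint f r)
    (hV : 8 ≤ V.card) (hV' : V.card ≤ 10) : R.card + 3 ≤ 3 * V.card := by
  obtain ⟨W, hWdef⟩ : ∃ W, W = V \ (e ∪ f) := ⟨_, rfl⟩
  have hW : W.card + 6 = V.card := by
    have := card_sdiff_add_card_eq_card (union_subset he hf)
    rw [card_union_of_disjoint hef, ← hWdef] at this; omega
  -- split
  set R1 := R.filter (fun r => ¬ r ⊆ e ∪ f)
  set R2 := R.filter (fun r => r ⊆ e ∪ f)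
  have hcard : R2.card + R1.card = R.card := card_filter_add_card_filter_not _
  have h1 : R1.card ≤ ∑ x ∈ e, ∑ y ∈ f, (th R x y W).card := by
    have : R1 ⊆ e.biUnion fun x => f.biUnion fun y => (th R x y W).image (fun z => {x, y, z}) := by
      intro r hr
      obtain ⟨hr, hr2⟩ := mem_filter.1 hr
      obtain ⟨x, hx, hxr⟩ := not_disjoint_iff.1 (hRe r hr)
      obtain ⟨y, hy, hyr⟩ := not_disjoint_iff.1 (hRf r hr)
      have hxy : x ≠ y := fun h => disjoint_left.1 hef hx (h ▸ hy)
      obtain ⟨z, hz1, hz2, rfl⟩ := triple_of_pair (hT r hr).2 hxr hyr hxy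
      simp only [mem_biUnion, mem_image]
      refine ⟨x, hx, y, hy, z, mem_th.2 ⟨?_, hr⟩, rfl⟩
      rw [hWdef]
      refine mem_sdiff.2 ⟨(hT _ hr).1 (by simp), fun hz => hr2 ?_⟩
      intro u; simp only [mem_insert, mem_singleton]
      rintro (rfl | rfl | rfl)
      · exact mem_union_left _ hx
      · exact mem_union_right _ hy
      · exact hz
    refine (card_le_card this).trans (card_biUnion_le.trans (sum_le_sum fun x _ =>
      card_biUnion_le.trans (sum_le_sum fun y _ => card_image_le)))
  have h2 : 2 * R2.card ≤ ∑ x ∈ e, ∑ y ∈ f, (R2.filter fun r => x ∈ r ∧ y ∈ r).card := by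
    have : ∀ r ∈ R2, 2 ≤ ∑ x ∈ e, ∑ y ∈ f, if x ∈ r ∧ y ∈ r then 1 else 0 := by
      intro r hr
      obtain ⟨hr, hr2⟩ := mem_filter.1 hr
      have e1 : ∑ x ∈ e, ∑ y ∈ f, (if x ∈ r ∧ y ∈ r then 1 else 0) = (e ∩ r).card * (f ∩ r).card := by
        rw [← filter_mem_eq_inter, ← filter_mem_eq_inter, card_filter, card_filter, sum_mul_sum]
        refine sum_congr rfl fun x _ => sum_congr rfl fun y _ => ?_
        by_cases h1 : x ∈ r <;> by_cases h2 : y ∈ r <;> simp [h1, h2]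
      have e2 : (e ∩ r).card + (f ∩ r).card = 3 := by
        rw [← card_union_of_disjoint (hef.mono inter_subset_left inter_subset_left),
          ← union_inter_distrib_right, inter_eq_right.2 hr2, (hT r hr).2]
      have e3 : 0 < (e ∩ r).card := card_pos.2 (not_disjoint_iff_nonempty_inter.1 (hRe r hr))
      have e4 : 0 < (f ∩ r).card := card_pos.2 (not_disjoint_iff_nonempty_inter.1 (hRf r hr))
      rw [e1]
      nlinarith
    calc 2 * R2.card = ∑ r ∈ R2, 2 := by simp [mul_comm]
      _ ≤ ∑ r ∈ R2, ∑ x ∈ e, ∑ y ∈ f, if x ∈ r ∧ y ∈ r then 1 else 0 := sum_le_sum this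
      _ = ∑ x ∈ e, ∑ r ∈ R2, ∑ y ∈ f, if x ∈ r ∧ y ∈ r then 1 else 0 := sum_comm
      _ = ∑ x ∈ e, ∑ y ∈ f, ∑ r ∈ R2, if x ∈ r ∧ y ∈ r then 1 else 0 :=
          sum_congr rfl fun _ _ => sum_comm
      _ = _ := by simp only [card_filter]
  have h3 : ∀ x y s t u v : α, x ≠ y → e ∪ f = {x, y, s, t, u, v} →
      (R2.filter fun r => x ∈ r ∧ y ∈ r).card ≤ (th R x y {s, t, u, v}).card := by
    intro x y s t u v hxy hE
    apply card_pair' hxy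
    intro r hr
    simp only [mem_filter, R2] at hr
    exact ⟨hr.1.1, (hT r hr.1.1).2, hr.2.1, hr.2.2, hE ▸ hr.1.2⟩
  have nW : ∀ x ∈ W, x ∉ e ∧ x ∉ f := by
    intro x hx; simp [hWdef] at hx; tauto
  obtain ⟨a, b, c, hab, hac, hbc, rfl⟩ := card_eq_three.1 ce
  obtain ⟨p, q, s, hpq, hps, hqs, rfl⟩ := card_eq_three.1 cf
  simp only [disjoint_insert_left, disjoint_insert_right, disjoint_singleton_left, mem_insert, mem_singleton, not_or, disjoint_singleton_right] at hef nW
  obtain ⟨⟨ha1, ha2, ha3⟩, ⟨hb1, hb2, hb3⟩, hc1, hc2, hc3⟩ : (a ≠ p ∧ a ≠ q ∧ a ≠ s) ∧ (b ≠ p ∧ b ≠ q ∧ b ≠ s) ∧ (c ≠ p ∧ c ≠ q ∧ c ≠ s) := by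
    clear * - hef
    tauto
  have hqp := hpq.symm
  have hsp := hps.symm
  have hsq := hqs.symm
  have hW2 : 2 ≤ W.card := by omega
  have M : ∀ x y z u v w : α, [x, y, z, u, v, w].Nodup → ([x, y, z, u, v, w].Perm [a, b, c, p, q, s]) →
    2 * ((th R x y W).card + (th R z u W).card + (th R v w W).card) +
      ((R2.filter fun r => x ∈ r ∧ y ∈ r).card + (R2.filter fun r => z ∈ r ∧ u ∈ r).card
        + (R2.filter fun r => v ∈ r ∧ w ∈ r).card) ≤ 2 * W.card + 10 := by
    intro x y z u v w hnd hperm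
    have hmem : ∀ t, t ∈ ({a, b, c} ∪ {p, q, s} : Finset α) ↔ t ∈ [x, y, z, u, v, w] := by
      intro t; rw [hperm.mem_iff]; simp only [mem_insert, mem_singleton, mem_union, List.mem_cons, List.not_mem_nil, or_false, or_assoc]
    have m := matching_bound h hnd (W := W) (fun t ht ht' => by
      rw [hperm.mem_iff] at ht'
      have := nW t ht
      simp at ht'; tauto) hW2 (by omega)
    have hn := hnd
    simp only [List.nodup_cons, List.mem_cons, List.not_mem_nil, or_false, not_or] at hn
    have x1 := h3 x y z u v w hn.1.1 (by ext t; rw [hmem]; simp)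
    have x2 := h3 z u x y v w hn.2.2.1.1 (by ext t; rw [hmem]; simp only [mem_insert, mem_singleton, List.mem_cons, List.not_mem_nil, or_false]; constructor <;> (intro h; rcases h with h|h|h|h|h|h <;> simp [h]))
    have x3 := h3 v w x y z u hn.2.2.2.2.1 (by ext t; rw [hmem]; simp only [mem_insert, mem_singleton, List.mem_cons, List.not_mem_nil, or_false]; constructor <;> (intro h; rcases h with h|h|h|h|h|h <;> simp [h]))
    omega
  have pm : ∀ p q s : α, p ≠ q → p ≠ s → q ≠ s → a ≠ p → a ≠ q → a ≠ s → b ≠ p → b ≠ q → b ≠ s → c ≠ p → c ≠ q → c ≠ s → [a, p, b, q, c, s].Nodup ∧ [a, p, b, q, c, s].Perm [a, b, c, p, q, s] := by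
    intro p q s
    intros
    constructor
    · simp; grind
    · refine List.Perm.cons _ ?_
      refine (List.Perm.swap _ _ _).trans (List.Perm.cons _ ?_)
      refine (List.Perm.cons _ (List.Perm.swap _ _ _)).trans (List.Perm.swap _ _ _)
  have M' : ∀ p' q' s' : α, p' ≠ q' → p' ≠ s' → q' ≠ s' → [p', q', s'].Perm [p, q, s] →
     a ≠ p' → a ≠ q' → a ≠ s' → b ≠ p' → b ≠ q' → b ≠ s' → c ≠ p' → c ≠ q' → c ≠ s' →
    2 * ((th R a p' W).card + (th R b q' W).card + (th R c s' W).card) +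
      ((R2.filter fun r => a ∈ r ∧ p' ∈ r).card + (R2.filter fun r => b ∈ r ∧ q' ∈ r).card
        + (R2.filter fun r => c ∈ r ∧ s' ∈ r).card) ≤ 2 * W.card + 10 := by
    intro p' q' s' i1 i2 i3 hp j1 j2 j3 j4 j5 j6 j7 j8 j9
    obtain ⟨g1, g2⟩ := pm p' q' s' i1 i2 i3 j1 j2 j3 j4 j5 j6 j7 j8 j9
    exact M _ _ _ _ _ _ g1 (g2.trans (List.Perm.cons _ (List.Perm.cons _ (List.Perm.cons _ hp))))
  have P2 : [p, s, q].Perm [p, q, s] := List.Perm.cons _ (List.Perm.swap _ _ _)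
  have P3 : [q, p, s].Perm [p, q, s] := List.Perm.swap _ _ _
  have P4 : [q, s, p].Perm [p, q, s] := (List.Perm.cons _ (List.Perm.swap _ _ _)).trans P3
  have P5 : [s, p, q].Perm [p, q, s] := (List.Perm.swap _ _ _).trans P2
  have P6 : [s, q, p].Perm [p, q, s] := (List.Perm.swap _ _ _).trans P4
  have m1 := M' p q s ‹_› ‹_› ‹_› (List.Perm.refl _) ‹_› ‹_› ‹_› ‹_› ‹_› ‹_› ‹_› ‹_› ‹_›
  have m2 := M' p s q ‹_› ‹_› ‹_› P2 ‹_› ‹_› ‹_› ‹_› ‹_› ‹_› ‹_› ‹_› ‹_›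
  have m3 := M' q p s ‹_› ‹_› ‹_› P3 ‹_› ‹_› ‹_› ‹_› ‹_› ‹_› ‹_› ‹_› ‹_›
  have m4 := M' q s p ‹_› ‹_› ‹_› P4 ‹_› ‹_› ‹_› ‹_› ‹_› ‹_› ‹_› ‹_› ‹_›
  have m5 := M' s p q ‹_› ‹_› ‹_› P5 ‹_› ‹_› ‹_› ‹_› ‹_› ‹_› ‹_› ‹_› ‹_›
  have m6 := M' s q p ‹_› ‹_› ‹_› P6 ‹_› ‹_› ‹_› ‹_› ‹_› ‹_› ‹_› ‹_› ‹_›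
  have s3 : ∀ (F : α → ℕ) (x y z : α), x ≠ y → x ≠ z → y ≠ z → ∑ t ∈ ({x, y, z} : Finset α), F t = F x + F y + F z := by
    intro F x y z h1 h2 h3
    rw [sum_insert (by simp [h1, h2]), sum_insert (by simp [h3]), sum_singleton]; omega
  simp only [s3 _ a b c hab hac hbc, s3 _ p q s hpq hps hqs] at h1 h2
  clear * - h1 h2 m1 m2 m3 m4 m5 m6 hcard hW
  linarith

end RP4

namespace RP4
variable {α : Type*} [DecidableEq α]

/-- weight of a pair `q` seen from `e` -/
def wt (R : Finset (Finset α)) (e q : Finset α) : ℕ := (e.filter fun i => insert i q ∈ R).card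

theorem wt_le {R : Finset (Finset α)} {e q : Finset α} : wt R e q ≤ e.card := card_filter_le _ _

theorem wt_disj {R : Finset (Finset α)} (h : NoP4 R) {e q q' : Finset α} (he : e.card = 3)
    (c : q.card = 2) (c' : q'.card = 2) (hd : Disjoint q q') (h1 : Disjoint q e)
    (h2 : Disjoint q' e) : wt R e q + wt R e q' ≤ 4 := by
  obtain ⟨a, b, hab, rfl⟩ := card_eq_two.1 c
  obtain ⟨a', b', hab', rfl⟩ := card_eq_two.1 c'
  have ro : ∀ a b x : α, ({a, b, x} : Finset α) = insert x {a, b} := by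
    intro a b x; ext z; simp only [mem_insert, mem_singleton]; tauto
  simp only [disjoint_insert_left, disjoint_insert_right, disjoint_singleton_left, mem_insert,
    mem_singleton, not_or] at hd h1 h2
  obtain ⟨h11, h12⟩ := h1
  obtain ⟨h21, h22⟩ := h2
  have hne : ∀ x ∈ e, x ≠ a ∧ x ≠ b ∧ x ≠ a' ∧ x ≠ b' := by
    intro x hx
    refine ⟨?_, ?_, ?_, ?_⟩ <;> rintro rfl <;> contradiction
  have := (sunflower_card h (a := a) (b := b) (c := a') (d := b')
    (X := e.filter fun i => insert i {a, b} ∈ R) (Y := e.filter fun i => insert i {a', b'} ∈ R)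
    (S := e) (by grind) (by grind) (by grind) (by grind) he.ge (filter_subset _ _)
    (filter_subset _ _) (fun x hx => ⟨hne x (mem_filter.1 hx).1, by
      rw [ro]; exact (mem_filter.1 hx).2⟩) (fun x hx => ⟨hne x (mem_filter.1 hx).1, by
      rw [ro]; exact (mem_filter.1 hx).2⟩)).1
  unfold wt; omega

theorem fiber {R F Q : Finset (Finset α)} {e : Finset α}
    (h : ∀ r ∈ F, r ∈ R ∧ ∃ q ∈ Q, ∃ i ∈ e, r = insert i q) : F.card ≤ ∑ q ∈ Q, wt R e q := by
  have : F ⊆ Q.biUnion fun q => (e.filter fun i => insert i q ∈ R).image fun i => insert i q := by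
    intro r hr
    obtain ⟨h1, q, hq, i, hi, rfl⟩ := h r hr
    exact mem_biUnion.2 ⟨q, hq, mem_image.2 ⟨i, mem_filter.2 ⟨hi, h1⟩, rfl⟩⟩
  exact (card_le_card this).trans (card_biUnion_le.trans (sum_le_sum fun q _ => card_image_le))

/-- triples containing `L` -/
theorem card_contain {F : Finset (Finset α)} {L U : Finset α} (hLU : L ⊆ U)
    (h : ∀ t ∈ F, t.card = 3 ∧ L ⊆ t ∧ t ⊆ U) :
    F.card ≤ (U.card - L.card).choose (3 - L.card) := by
  rw [← card_sdiff_of_subset hLU, ← card_powersetCard]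
  refine card_le_card_of_injOn (fun t => t \ L) ?_ ?_
  · intro t ht
    obtain ⟨h1, h2, h3⟩ := h t ht
    simp only [mem_coe, mem_powersetCard]
    exact ⟨sdiff_subset_sdiff h3 le_rfl, by rw [card_sdiff_of_subset h2, h1]⟩
  · intro t ht s hs hts
    have := congrArg (fun z => z ∪ L) hts
    simpa [sdiff_union_of_subset (h t ht).2.1, sdiff_union_of_subset (h s hs).2.1] using this

/-- one side of the covering analysis -/
theorem cov_side {U K : Finset α} {B Q : Finset (Finset α)} (hB : Tri U B)
    (hK : ∀ t ∈ B, K ⊆ t)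
    (hQ : ∀ q ∈ Q, q.card = 2 ∧ q ⊆ U ∧ Disjoint q K ∧ ∀ t ∈ B, ¬ Disjoint q t)
    {x y : α} (hxy : x ≠ y) (hq : ({x, y} : Finset α) ∈ Q) (hne : ∃ t ∈ B, x ∉ t) :
    ∃ k, K.card + k ≤ 2 ∧ (Q.filter fun q => x ∈ q ∧ y ∉ q).card ≤ k ∧
      (B.filter fun t => x ∉ t).card ≤ (U.card - 2 - K.card - k).choose (2 - K.card - k) := by
  obtain ⟨-, hqU, hqK, hqc⟩ := hQ _ hq
  have hxU : x ∈ U := hqU (by simp)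
  have hyU : y ∈ U := hqU (by simp)
  have hxK : x ∉ K := fun h => disjoint_left.1 hqK (by simp) h
  have hyK : y ∉ K := fun h => disjoint_left.1 hqK (by simp) h
  set C := U.filter fun c => c ≠ x ∧ c ≠ y ∧ ({x, c} : Finset α) ∈ Q with hC
  have hCK : Disjoint C (insert y K) := by
    rw [disjoint_left]
    intro c hc hc'
    simp only [hC, mem_filter] at hc
    rcases mem_insert.1 hc' with rfl | h
    · exact hc.2.2.1 rfl
    · exact disjoint_left.1 (hQ _ hc.2.2.2).2.2.1 (by simp) h
  obtain ⟨L, hL⟩ : ∃ L, L = C ∪ insert y K := ⟨_, rfl⟩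
  have hLc : L.card = C.card + (K.card + 1) := by
    rw [hL, card_union_of_disjoint hCK, card_insert_of_notMem hyK]
  have hLt : ∀ t ∈ B.filter fun t => x ∉ t, t.card = 3 ∧ L ⊆ t ∧ t ⊆ U.erase x := by
    intro t ht
    obtain ⟨ht, hxt⟩ := mem_filter.1 ht
    have aux : ∀ c, ({x, c} : Finset α) ∈ Q → c ∈ t := by
      intro c hc
      have := (hQ _ hc).2.2.2 t ht
      simpa [hxt] using this
    refine ⟨(hB t ht).2, ?_, ?_⟩
    · rw [hL]
      intro z hz
      rcases mem_union.1 hz with h | h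
      · simp only [hC, mem_filter] at h
        exact aux z h.2.2.2
      · rcases mem_insert.1 h with rfl | h
        · exact aux _ hq
        · exact hK t ht h
    · intro z hz
      exact mem_erase.2 ⟨by rintro rfl; exact hxt hz, (hB t ht).1 hz⟩
  obtain ⟨t0, ht0, hxt0⟩ := hne
  have h0 := hLt t0 (mem_filter.2 ⟨ht0, hxt0⟩)
  have h1 := card_le_card h0.2.1
  have h2 := card_contain (h0.2.1.trans h0.2.2) hLt
  refine ⟨C.card, by omega, ?_, ?_⟩
  · have : (Q.filter fun q => x ∈ q ∧ y ∉ q) ⊆ C.image fun c => {x, c} := by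
      intro q hq'
      obtain ⟨h3, h4, h5⟩ := mem_filter.1 hq'
      obtain ⟨c, hc, rfl⟩ := pair_of_one (hQ q h3).1 h4
      refine mem_image.2 ⟨c, ?_, rfl⟩
      simp only [hC, mem_filter]
      refine ⟨(hQ _ h3).2.1 (by simp), hc, ?_, h3⟩
      rintro rfl; simp at h5
    exact (card_le_card this).trans card_image_le
  · rw [card_erase_of_mem hxU, hLc] at h2
    convert h2 using 2 <;> omega

theorem cov_common {U K : Finset α} {B Q : Finset (Finset α)} {w : Finset α → ℕ} (hB : Tri U B)
    (hK : ∀ t ∈ B, K ⊆ t) (hKU : K ⊆ U)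
    (hQ : ∀ q ∈ Q, q.card = 2 ∧ q ⊆ U ∧ Disjoint q K ∧ ∀ t ∈ B, ¬ Disjoint q t)
    (hne : Q.Nonempty) (hk : ∀ v, v ∉ K → ∃ t ∈ B, v ∉ t)
    (hd : ∀ q ∈ Q, ∀ q' ∈ Q, Disjoint q q' → w q + w q' ≤ 4) :
    ∃ x y, x ≠ y ∧ ({x, y} : Finset α) ∈ Q ∧ ∃ kx ky, K.card + kx ≤ 2 ∧ K.card + ky ≤ 2 ∧
      (B.filter fun t => x ∉ t).card ≤ (U.card - 2 - K.card - kx).choose (2 - K.card - kx) ∧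
      (B.filter fun t => y ∉ t).card ≤ (U.card - 2 - K.card - ky).choose (2 - K.card - ky) ∧
      (B.filter fun t => x ∈ t ∧ y ∈ t).card ≤ (U.card - 2 - K.card).choose (1 - K.card) ∧
      B.card ≤ (B.filter fun t => x ∈ t ∧ y ∈ t).card + (B.filter fun t => x ∉ t).card +
        (B.filter fun t => y ∉ t).card ∧
      ∑ q ∈ Q, w q ≤ w {x, y} * (1 + kx + ky) +
        min (w {x, y}) (4 - w {x, y}) * (Q.filter fun q => x ∉ q ∧ y ∉ q).card := by
  obtain ⟨q0, hq0, hmax⟩ := exists_max_image Q w hne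
  obtain ⟨x, y, hxy, rfl⟩ := card_eq_two.1 (hQ q0 hq0).1
  obtain ⟨-, hqU, hqK, hqc⟩ := hQ _ hq0
  have hxK : x ∉ K := fun h => disjoint_left.1 hqK (by simp) h
  have hyK : y ∉ K := fun h => disjoint_left.1 hqK (by simp) h
  obtain ⟨kx, a1, a2, a3⟩ := cov_side hB hK hQ hxy hq0 (hk x hxK)
  obtain ⟨ky, b1, b2, b3⟩ := cov_side hB hK hQ hxy.symm (by rwa [Finset.pair_comm]) (hk y hyK)
  refine ⟨x, y, hxy, hq0, kx, ky, a1, b1, a3, b3, ?_, ?_, ?_⟩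
  · have hcard : ({x, y} ∪ K).card = 2 + K.card := by
      rw [card_union_of_disjoint hqK, Finset.card_pair hxy]
    have := card_contain (F := B.filter fun t => x ∈ t ∧ y ∈ t) (L := {x, y} ∪ K) (U := U)
      (union_subset hqU hKU) (by
        intro t ht
        obtain ⟨h1, h2, h3⟩ := mem_filter.1 ht
        refine ⟨(hB t h1).2, union_subset ?_ (hK t h1), (hB t h1).1⟩
        intro z; simp only [mem_insert, mem_singleton]; rintro (rfl | rfl) <;> assumption)
    rw [hcard] at this
    convert this using 2 <;> omega
  · have := card_le_list (F := B) [B.filter fun t => x ∈ t ∧ y ∈ t, B.filter fun t => x ∉ t,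
      B.filter fun t => y ∉ t] (by
        intro t ht
        by_cases h1 : x ∈ t
        · by_cases h2 : y ∈ t
          · exact ⟨_, List.mem_cons_self .., by simp [*]⟩
          · exact ⟨B.filter fun t => y ∉ t, by simp, by simp [*]⟩
        · exact ⟨B.filter fun t => x ∉ t, by simp, by simp [*]⟩)
    simpa [add_assoc] using this
  · rw [← sum_filter_add_sum_filter_not Q (fun q => x ∉ q ∧ y ∉ q), add_comm]
    have e1 := sum_le_card_nsmul (Q.filter fun q => x ∉ q ∧ y ∉ q) w
      (min (w {x, y}) (4 - w {x, y})) (by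
        intro q hq
        obtain ⟨h1, h2, h3⟩ := mem_filter.1 hq
        have := hd _ hq0 q h1 (by simp [h2, h3])
        have := hmax q h1
        rw [le_min_iff]; omega)
    have e2 := sum_le_card_nsmul (Q.filter fun q => ¬ (x ∉ q ∧ y ∉ q)) w
      (w {x, y}) (by
        intro q hq
        exact hmax q (mem_filter.1 hq).1)
    have e3 : (Q.filter fun q => ¬ (x ∉ q ∧ y ∉ q)).card ≤ 1 + kx + ky := by
      have := card_le_list (F := Q.filter fun q => ¬ (x ∉ q ∧ y ∉ q))
        [{{x, y}}, Q.filter fun q => x ∈ q ∧ y ∉ q, Q.filter fun q => y ∈ q ∧ x ∉ q] (by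
        intro t ht
        obtain ⟨ht, h3⟩ := mem_filter.1 ht
        by_cases h1 : x ∈ t
        · by_cases h2 : y ∈ t
          · refine ⟨_, List.mem_cons_self .., ?_⟩
            rw [mem_singleton]; symm
            apply eq_of_subset_of_card_le
            · intro z; simp only [mem_insert, mem_singleton]; rintro (rfl | rfl) <;> assumption
            · rw [(hQ t ht).1, Finset.card_pair hxy]
          · exact ⟨Q.filter fun q => x ∈ q ∧ y ∉ q, by simp, by simp [*]⟩
        · exact ⟨Q.filter fun q => y ∈ q ∧ x ∉ q, by simp, by simp [*]; tauto⟩)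
      simp only [List.map_cons, List.map_nil, List.sum_cons, List.sum_nil, card_singleton] at this
      omega
    simp only [smul_eq_mul] at e1 e2
    have e4 := Nat.mul_le_mul_right (w {x, y}) e3
    rw [mul_comm (w {x, y}), mul_comm (min _ _)]
    exact add_le_add (e2.trans e4) e1

end RP4

namespace RP4
variable {α : Type*} [DecidableEq α]

theorem numside {d w k b c : ℕ} (hk : k ≤ 2) (h : b ≤ (d - k).choose (2 - k)) (hc : b ≤ c) :
    b + w * k ≤ max (min c (d.choose 2)) (max (min c (d - 1) + w) (min c 1 + 2 * w)) := by
  interval_cases k <;> simp at h <;> simp <;> omega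

theorem covA_num {d w kx ky bx b_y bxy p B S c p0 : ℕ} (hw : w ≤ 3) (hd2 : 2 ≤ d) (hd5 : d ≤ 5)
    (hd : d = 2 → w ≤ 2) (hkx : kx ≤ 2) (hky : ky ≤ 2) (hy : b_y ≤ (d - kx).choose (2 - kx))
    (hx : bx ≤ (d - ky).choose (2 - ky)) (hxy : bxy ≤ d) (hB : B ≤ bxy + b_y + bx)
    (hS : S ≤ w * (1 + kx + ky) + min w (4 - w) * p)
    (hp : p ≤ p0) (hcx : bx ≤ c) (hcy : b_y ≤ c)
    (h : p0 = 0 ∨ (bxy ≤ 2 ∧ p0 = d ∧ c = 2 * d - 3) ∨ (bxy ≤ 2 ∧ p0 = 2 * d - 3 ∧ c = 1)) :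
    B + S ≤ if d = 5 then 28 else if d = 4 then 24 else if d = 3 then 22 else 18 := by
  have h1 := numside (w := w) hkx hy hcy
  have h2 := numside (w := w) hky hx hcx
  have h3 := Nat.mul_le_mul_left (min w (4 - w)) hp
  have h4 : B + S ≤ w + bxy + (b_y + w * kx) + (bx + w * ky) + min w (4 - w) * p0 := by
    rw [mul_add, mul_add] at hS; omega
  clear hS hkx hky hy hx hp h3
  generalize b_y + w * kx = X at *
  generalize bx + w * ky = Y at *
  rcases h with rfl | ⟨h, rfl, rfl⟩ | ⟨h, rfl, rfl⟩
  · rw [mul_zero] at h4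
    interval_cases d <;> simp [Nat.choose] at * <;> omega
  · interval_cases p0 <;> interval_cases w <;> simp [Nat.choose] at * <;> omega
  · interval_cases d <;> interval_cases w <;> simp [Nat.choose] at * <;> omega

theorem covA {U : Finset α} {B Q : Finset (Finset α)} {w : Finset α → ℕ} {d : ℕ} (hB : Tri U B)
    (hQ : ∀ q ∈ Q, q.card = 2 ∧ q ⊆ U ∧ ∀ t ∈ B, ¬ Disjoint q t)
    (hne : Q.Nonempty) (hk : ∀ v, ∃ t ∈ B, v ∉ t)
    (hd : ∀ q ∈ Q, ∀ q' ∈ Q, Disjoint q q' → w q + w q' ≤ 4)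
    (hU : U.card = d + 2) (hw : ∀ q ∈ Q, w q ≤ 3) (hd2 : 2 ≤ d) (hd5 : d ≤ 5)
    (hdw : d = 2 → ∀ q ∈ Q, w q ≤ 2) :
    B.card + ∑ q ∈ Q, w q ≤ if d = 5 then 28 else if d = 4 then 24 else if d = 3 then 22 else 18 := by
  obtain ⟨x, y, hxy, hq, kx, ky, a1, b1, a2, b2, c1, c2, c3⟩ := cov_common (K := ∅) (w := w) hB
    (by simp) (by simp) (fun q hq => ⟨(hQ q hq).1, (hQ q hq).2.1, by simp, (hQ q hq).2.2⟩) hne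
    (fun v _ => hk v) hd
  simp only [card_empty, zero_add, hU, Nat.add_sub_cancel, tsub_zero, Nat.choose_one_right] at a1 b1 a2 b2 c1
  obtain ⟨-, hqU, hqc⟩ := hQ _ hq
  have hxU : x ∈ U := hqU (by simp)
  have hyU : y ∈ U := hqU (by simp)
  by_cases hp : (Q.filter fun q => x ∉ q ∧ y ∉ q) = ∅
  · rw [hp] at c3
    exact covA_num (c := B.card) (hw _ hq) hd2 hd5 (fun h => hdw h _ hq) a1 b1 a2 b2 c1 c2 c3
      (p0 := 0) (by simp) (card_le_card (filter_subset _ _)) (card_le_card (filter_subset _ _)) (Or.inl rfl)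
  obtain ⟨q', hq'⟩ := nonempty_iff_ne_empty.2 hp
  obtain ⟨hq'Q, hxq', hyq'⟩ := mem_filter.1 hq'
  obtain ⟨D, hD⟩ : ∃ D, D = (U.erase x).erase y := ⟨_, rfl⟩
  have hDc : D.card = d := by
    rw [hD, card_erase_of_mem (mem_erase.2 ⟨hxy.symm, hyU⟩), card_erase_of_mem hxU]; omega
  have hQD : ∀ q ∈ (Q.filter fun q => x ∉ q ∧ y ∉ q), q ⊆ D := by
    intro q hq z hz
    obtain ⟨h1, h2, h3⟩ := mem_filter.1 hq
    rw [hD, mem_erase, mem_erase]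
    exact ⟨by rintro rfl; exact h3 hz, by rintro rfl; exact h2 hz, (hQ q h1).2.1 hz⟩
  have mx : ∀ t ∈ (B.filter fun t => x ∉ t), y ∈ t := by
    intro t ht
    obtain ⟨h1, h2⟩ := mem_filter.1 ht
    simpa [h2] using hqc t h1
  have my : ∀ t ∈ (B.filter fun t => y ∉ t), x ∈ t := by
    intro t ht
    obtain ⟨h1, h2⟩ := mem_filter.1 ht
    simpa [h2] using hqc t h1
  obtain ⟨Lx, hLx⟩ : ∃ L, L = (B.filter fun t => x ∉ t).image (fun t => t.erase y) := ⟨_, rfl⟩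
  obtain ⟨Ly, hLy⟩ : ∃ L, L = (B.filter fun t => y ∉ t).image (fun t => t.erase x) := ⟨_, rfl⟩
  have cx := link_card mx
  have cy := link_card my
  rw [← hLx] at cx
  rw [← hLy] at cy
  have hL : ∀ g ∈ Lx ∪ Ly, g.card = 2 ∧ g ⊆ D ∧ ∀ q ∈ (Q.filter fun q => x ∉ q ∧ y ∉ q), ¬ Disjoint q g := by
    intro g hg
    rw [mem_union, hLx, hLy, mem_image, mem_image] at hg
    rcases hg with ⟨t, ht, rfl⟩ | ⟨t, ht, rfl⟩
    · have hyt := mx t ht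
      obtain ⟨h1, h2⟩ := mem_filter.1 ht
      refine ⟨by rw [card_erase_of_mem hyt, (hB t h1).2], ?_, ?_⟩
      · intro z hz
        obtain ⟨h3, h4⟩ := mem_erase.1 hz
        rw [hD, mem_erase, mem_erase]
        exact ⟨h3, by rintro rfl; exact h2 h4, (hB t h1).1 h4⟩
      · intro q hq
        obtain ⟨h3, h4, h5⟩ := mem_filter.1 hq
        obtain ⟨z, hz, hz'⟩ := not_disjoint_iff.1 ((hQ q h3).2.2 t h1)
        exact not_disjoint_iff.2 ⟨z, hz, mem_erase.2 ⟨by rintro rfl; exact h5 hz, hz'⟩⟩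
    · have hyt := my t ht
      obtain ⟨h1, h2⟩ := mem_filter.1 ht
      refine ⟨by rw [card_erase_of_mem hyt, (hB t h1).2], ?_, ?_⟩
      · intro z hz
        obtain ⟨h3, h4⟩ := mem_erase.1 hz
        rw [hD, mem_erase, mem_erase]
        exact ⟨by rintro rfl; exact h2 h4, h3, (hB t h1).1 h4⟩
      · intro q hq
        obtain ⟨h3, h4, h5⟩ := mem_filter.1 hq
        obtain ⟨z, hz, hz'⟩ := not_disjoint_iff.1 ((hQ q h3).2.2 t h1)
        exact not_disjoint_iff.2 ⟨z, hz, mem_erase.2 ⟨by rintro rfl; exact h4 hz, hz'⟩⟩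
  have hbxy : (B.filter fun t => x ∈ t ∧ y ∈ t).card ≤ 2 := by
    rw [← (hQ q' hq'Q).1]
    apply card_pair hxy
    intro t ht
    obtain ⟨h1, h2, h3⟩ := mem_filter.1 ht
    refine ⟨(hB t h1).2, h2, h3, ?_⟩
    obtain ⟨c, h4, h5, rfl⟩ := triple_of_pair (hB t h1).2 h2 h3 hxy
    have : c ∈ q' := by
      have := (hQ q' hq'Q).2.2 _ h1
      simpa [hxq', hyq'] using this
    intro z; simp only [mem_insert, mem_singleton]; rintro (rfl | rfl | rfl) <;> simp [this]
  have hit : ∀ L ⊆ Lx ∪ Ly, L.card + 3 ≤ 2 * d := by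
    intro L hLL
    obtain ⟨u, v, huv, rfl⟩ := card_eq_two.1 (hQ q' hq'Q).1
    have := hQD _ hq'
    rw [← hDc]
    refine card_hit1 (this (by simp)) (this (by simp)) huv ?_
    intro g hg
    obtain ⟨h1, h2, h3⟩ := hL g (hLL hg)
    refine ⟨h1, h2, ?_⟩
    have := h3 _ hq'
    simp at this; tauto
  by_cases h2 : ∃ g1 ∈ Lx ∪ Ly, ∃ g2 ∈ Lx ∪ Ly, g1 ≠ g2
  · obtain ⟨g1, hg1, g2, hg2, hg⟩ := h2
    have hp' := card_hit2 (G := Q.filter fun q => x ∉ q ∧ y ∉ q) (hL g1 hg1).2.1 (hL g2 hg2).2.1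
      (hL g1 hg1).1 (hL g2 hg2).1 hg (fun q hq => ⟨(hQ q (mem_filter.1 hq).1).1, hQD q hq,
        (hL g1 hg1).2.2 q hq, (hL g2 hg2).2.2 q hq⟩)
    have e1 := hit Lx subset_union_left
    have e2 := hit Ly subset_union_right
    exact covA_num (c := 2 * d - 3) (hw _ hq) hd2 hd5 (fun h => hdw h _ hq) a1 b1 a2 b2 c1 c2 c3
      (p0 := d) (by omega) (by omega) (by omega) (Or.inr (Or.inl ⟨hbxy, rfl, rfl⟩))
  · push Not at h2
    have e0 : (Lx ∪ Ly).card ≤ 1 := card_le_one.2 h2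
    have e1 := card_le_card (subset_union_left (s₁ := Lx) (s₂ := Ly))
    have e2 := card_le_card (subset_union_right (s₁ := Lx) (s₂ := Ly))
    obtain ⟨t, ht, hxt⟩ := hk x
    have hg : t.erase y ∈ Lx ∪ Ly := by
      rw [mem_union, hLx]; left; exact mem_image.2 ⟨t, mem_filter.2 ⟨ht, hxt⟩, rfl⟩
    obtain ⟨h3, h4, h5⟩ := hL _ hg
    have hp' : (Q.filter fun q => x ∉ q ∧ y ∉ q).card + 3 ≤ 2 * d := by
      obtain ⟨u, v, huv, huv'⟩ := card_eq_two.1 h3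
      rw [huv'] at h4 h5
      rw [← hDc]
      refine card_hit1 (h4 (by simp)) (h4 (by simp)) huv ?_
      intro q hq
      refine ⟨(hQ q (mem_filter.1 hq).1).1, hQD q hq, ?_⟩
      have := h5 _ hq
      simp at this; tauto
    exact covA_num (c := 1) (hw _ hq) hd2 hd5 (fun h => hdw h _ hq) a1 b1 a2 b2 c1 c2 c3
      (p0 := 2 * d - 3) (by omega) (by omega) (by omega) (Or.inr (Or.inr ⟨hbxy, rfl, rfl⟩))

end RP4

namespace RP4
variable {α : Type*} [DecidableEq α]

theorem covB {U : Finset α} {B Q : Finset (Finset α)} {w : Finset α → ℕ} {m : ℕ} {v : α}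
    (hB : Tri U B) (hvU : v ∈ U) (hv : ∀ t ∈ B, v ∈ t)
    (hQ : ∀ q ∈ Q, q.card = 2 ∧ q ⊆ U ∧ v ∉ q ∧ ∀ t ∈ B, ¬ Disjoint q t)
    (hne : Q.Nonempty) (hk : ∀ z, z ≠ v → ∃ t ∈ B, z ∉ t)
    (hd : ∀ q ∈ Q, ∀ q' ∈ Q, Disjoint q q' → w q + w q' ≤ 4)
    (hU : U.card = m + 1) :
    ∃ q ∈ Q, ∃ kx ky p g gx gy : ℕ, kx ≤ 1 ∧ ky ≤ 1 ∧ p ≤ 1 ∧ B.card ≤ g + gx + gy ∧ g ≤ 1 ∧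
      (kx = 0 → gy ≤ m - 2) ∧ (kx = 1 → gy ≤ 1) ∧ (ky = 0 → gx ≤ m - 2) ∧ (ky = 1 → gx ≤ 1) ∧
      (p = 1 → g = 0 ∧ gx ≤ 2 ∧ gy ≤ 2 ∧ 4 ≤ m) ∧
      ∑ q ∈ Q, w q ≤ w q * (1 + kx + ky) + min (w q) (4 - w q) * p := by
  obtain ⟨x, y, hxy, hq, kx, ky, a1, b1, a2, b2, c1, c2, c3⟩ := cov_common (K := {v}) (w := w) hB
    (by simpa using hv) (by simpa using hvU)
    (fun q hq => ⟨(hQ q hq).1, (hQ q hq).2.1, by simpa using (hQ q hq).2.2.1, (hQ q hq).2.2.2⟩) hne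
    (fun z hz => hk z (by simpa using hz)) hd
  rw [card_singleton] at a1 b1 a2 b2 c1
  obtain ⟨-, hqU, hvq, hqc⟩ := hQ _ hq
  simp only [mem_insert, mem_singleton, not_or] at hvq
  have mx : ∀ t ∈ B, x ∉ t → y ∈ t := by
    intro t h1 h2
    simpa [h2] using hqc t h1
  have my : ∀ t ∈ B, y ∉ t → x ∈ t := by
    intro t h1 h2
    simpa [h2] using hqc t h1
  have side : ∀ k b, k ≤ 1 → b ≤ (U.card - 2 - 1 - k).choose (2 - 1 - k) →
      (k = 0 → b ≤ m - 2) ∧ (k = 1 → b ≤ 1) := by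
    intro k b h1 h2
    interval_cases k <;> simp at h2 <;> simp <;> omega
  obtain ⟨s1, s2⟩ := side kx _ (by omega) a2
  obtain ⟨s3, s4⟩ := side ky _ (by omega) b2
  have cg : (B.filter fun t => x ∈ t ∧ y ∈ t).card ≤ 1 := by simpa using c1
  refine ⟨_, hq, kx, ky, (Q.filter fun q => x ∉ q ∧ y ∉ q).card, (B.filter fun t => x ∈ t ∧ y ∈ t).card,
    (B.filter fun t => y ∉ t).card, (B.filter fun t => x ∉ t).card, by omega, by omega, ?_, by omega,
    cg, s1, s2, s3, s4, ?_, c3⟩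
  all_goals
    by_cases hp : (Q.filter fun q => x ∉ q ∧ y ∉ q) = ∅
    · simp [hp]
    obtain ⟨q', hq'⟩ := nonempty_iff_ne_empty.2 hp
  all_goals
    have hno : ∀ q ∈ (Q.filter fun q => x ∉ q ∧ y ∉ q), ∀ t ∈ B, ∀ a c, t = {v, a, c} → (a = x ∨ a = y) → c ∈ q := by
      intro q hq t ht a c htt ha
      obtain ⟨h1, h2, h3⟩ := mem_filter.1 hq
      have h4 := (hQ q h1).2.2.2 t ht
      have h5 := (hQ q h1).2.2.1
      rw [htt] at h4
      have h6 : a ∉ q := by rcases ha with rfl | rfl <;> assumption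
      simpa [h5, h6] using h4
    have hxyB : ∀ t ∈ B, x ∈ t → y ∉ t := by
      intro t ht h1 h2
      obtain ⟨c, h3, h4, rfl⟩ := triple_of_pair (hB t ht).2 (hv t ht) h1 hvq.1
      have h5 := hno q' hq' _ ht x c rfl (Or.inl rfl)
      obtain ⟨h6, h7, h8⟩ := mem_filter.1 hq'
      have : y = c := by
        have h9 := h2
        simp only [mem_insert, mem_singleton] at h9
        rcases h9 with h | h | h
        · exact absurd h.symm hvq.2
        · exact absurd h.symm hxy
        · exact h
      exact h8 (this ▸ h5)
    have hex : ∃ t ∈ B, ∃ t' ∈ B, ∃ a c a' c', t = {v, a, c} ∧ t' = {v, a', c'} ∧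
        (a = x ∨ a = y) ∧ (a' = x ∨ a' = y) ∧ c ≠ c' ∧ c ≠ v ∧ c' ≠ v := by
      have one : ∀ t ∈ B, ∃ a c, t = {v, a, c} ∧ (a = x ∨ a = y) ∧ c ≠ v := by
        intro t ht
        by_cases hxt : x ∈ t
        · obtain ⟨c, h3, h4, h⟩ := triple_of_pair (hB t ht).2 (hv t ht) hxt hvq.1
          exact ⟨x, c, h, Or.inl rfl, h3⟩
        · obtain ⟨c, h3, h4, h⟩ := triple_of_pair (hB t ht).2 (hv t ht) (mx t ht hxt) hvq.2
          exact ⟨y, c, h, Or.inr rfl, h3⟩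
      obtain ⟨t, ht, -⟩ := hk x (Ne.symm hvq.1)
      obtain ⟨a, c, h1, h2, h3⟩ := one t ht
      obtain ⟨t', ht', hc⟩ := hk c h3
      obtain ⟨a', c', h4, h5, h6⟩ := one t' ht'
      refine ⟨t, ht, t', ht', a, c, a', c', h1, h4, h2, h5, ?_, h3, h6⟩
      rintro rfl
      exact hc (h4 ▸ (by simp))
    obtain ⟨t, ht, t', ht', a, c, a', c', e1, e2, e3, e4, e5, e6, e7⟩ := hex
  · rw [card_le_one]
    have : ∀ q ∈ (Q.filter fun q => x ∉ q ∧ y ∉ q), q = {c, c'} := by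
      intro q hq
      symm
      apply eq_of_subset_of_card_le
      · intro z; simp only [mem_insert, mem_singleton]
        rintro (rfl | rfl)
        · exact hno q hq t ht a _ e1 e3
        · exact hno q hq t' ht' a' _ e2 e4
      · rw [(hQ q (mem_filter.1 hq).1).1, Finset.card_pair e5]
    intro q1 h1 q2 h2
    rw [this q1 h1, this q2 h2]
  · intro _
    obtain ⟨h6, h7, h8⟩ := mem_filter.1 hq'
    refine ⟨?_, ?_, ?_, ?_⟩
    · rw [card_eq_zero, filter_eq_empty_iff]
      intro t ht h
      exact hxyB t ht h.1 h.2
    · rw [← (hQ q' h6).1]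
      refine card_pair hvq.1 ?_
      intro t ht
      obtain ⟨ht, h1⟩ := mem_filter.1 ht
      refine ⟨(hB t ht).2, hv t ht, my t ht h1, ?_⟩
      obtain ⟨c, h3, h4, rfl⟩ := triple_of_pair (hB t ht).2 (hv t ht) (my t ht h1) hvq.1
      have := hno q' hq' _ ht x c rfl (Or.inl rfl)
      intro z; simp only [mem_insert, mem_singleton]; rintro (rfl | rfl | rfl) <;> simp [this]
    · rw [← (hQ q' h6).1]
      refine card_pair hvq.2 ?_
      intro t ht
      obtain ⟨ht, h1⟩ := mem_filter.1 ht
      refine ⟨(hB t ht).2, hv t ht, mx t ht h1, ?_⟩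
      obtain ⟨c, h3, h4, rfl⟩ := triple_of_pair (hB t ht).2 (hv t ht) (mx t ht h1) hvq.2
      have := hno q' hq' _ ht y c rfl (Or.inr rfl)
      intro z; simp only [mem_insert, mem_singleton]; rintro (rfl | rfl | rfl) <;> simp [this]
    · have hsub : insert v ({x, y} ∪ q') ⊆ U :=
        insert_subset hvU (union_subset hqU (hQ q' h6).2.1)
      have h9 := card_le_card hsub
      rw [card_insert_of_notMem, card_union_of_disjoint, Finset.card_pair hxy, (hQ q' h6).1] at h9
      · omega
      · simp [h7, h8]
      · simp [hvq, (hQ q' h6).2.2.1]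

end RP4

namespace RP4
variable {α : Type*} [DecidableEq α]

/-- translates of an explicit four-path in the cyclic group of order 7 -/
def zE (p : Fin 7 × Fin 4) : Finset (Fin 7) :=
  if p.2 = 0 then {p.1, p.1 + 1, p.1 + 2} else if p.2 = 1 then {p.1, p.1 + 1, p.1 + 4}
  else if p.2 = 2 then {p.1 + 3, p.1 + 4, p.1 + 6} else {p.1 + 3, p.1 + 5, p.1 + 6}

theorem zE_inj : Function.Injective zE := by decide

theorem zE_card : ∀ p, (zE p).card = 3 := by decide

theorem zE_path : ∀ i, ¬ Disjoint (zE (i, 0)) (zE (i, 1)) ∧ ¬ Disjoint (zE (i, 1)) (zE (i, 2)) ∧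
    ¬ Disjoint (zE (i, 2)) (zE (i, 3)) ∧ Disjoint (zE (i, 0)) (zE (i, 2)) ∧
    Disjoint (zE (i, 0)) (zE (i, 3)) ∧ Disjoint (zE (i, 1)) (zE (i, 3)) := by decide

theorem seven {U : Finset α} {B : Finset (Finset α)} (h : NoP4 B) (hT : Tri U B)
    (hU : U.card = 7) : B.card ≤ 28 := by
  obtain ⟨φ⟩ : Nonempty (Fin 7 ≃ U) := ⟨(Fintype.equivFinOfCardEq (by simpa using hU)).symm⟩
  let ψ : Fin 7 ↪ α := φ.toEmbedding.trans (Function.Embedding.subtype _)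
  have hψ : ∀ x ∈ U, ∃ i, ψ i = x := fun x hx => ⟨φ.symm ⟨x, hx⟩, by simp [ψ]⟩
  set B' := (powersetCard 3 (univ : Finset (Fin 7))).filter fun s => s.map ψ ∈ B with hB'
  have h1 : B.card ≤ B'.card := by
    have : B ⊆ B'.image (fun s => s.map ψ) := by
      intro t ht
      have e : (univ.filter fun i => ψ i ∈ t).map ψ = t := by
        ext x
        simp only [mem_map, mem_filter, mem_univ, true_and]
        constructor
        · rintro ⟨i, hi, rfl⟩; exact hi
        · intro hx
          obtain ⟨i, rfl⟩ := hψ x ((hT t ht).1 hx)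
          exact ⟨i, hx, rfl⟩
      refine mem_image.2 ⟨univ.filter fun i => ψ i ∈ t, ?_, e⟩
      refine mem_filter.2 ⟨mem_powersetCard.2 ⟨subset_univ _, ?_⟩, by rw [e]; exact ht⟩
      rw [← card_map ψ, e, (hT t ht).2]
    exact (card_le_card this).trans card_image_le
  have h2 : ∀ i, ∃ j, zE (i, j) ∉ B' := by
    intro i
    by_contra hcon
    push Not at hcon
    have hm : ∀ j, (zE (i, j)).map ψ ∈ B := fun j => (mem_filter.1 (hcon j)).2
    obtain ⟨p1, p2, p3, p4, p5, p6⟩ := zE_path i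
    refine h _ (hm 0) _ (hm 1) _ (hm 2) _ (hm 3) ?_ ?_ ?_ ?_ ?_ ?_ <;> rw [disjoint_map] <;> assumption
  choose j hj using h2
  have h3 : (univ.image fun i => zE (i, j i)).card = 7 := by
    rw [card_image_of_injective]
    · simp
    · intro a b hab
      exact (Prod.ext_iff.1 (zE_inj hab)).1
  have h4 : Disjoint B' (univ.image fun i => zE (i, j i)) := by
    rw [disjoint_left]
    intro s hs hs'
    obtain ⟨i, -, rfl⟩ := mem_image.1 hs'
    exact hj i hs
  have h5 := card_le_card (s := B' ∪ univ.image fun i => zE (i, j i))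
    (t := powersetCard 3 (univ : Finset (Fin 7))) (union_subset (filter_subset _ _) (by
      intro s hs
      obtain ⟨i, -, rfl⟩ := mem_image.1 hs
      exact mem_powersetCard.2 ⟨subset_univ _, zE_card _⟩))
  rw [card_union_of_disjoint h4, h3, card_powersetCard] at h5
  simp [Nat.choose] at h5
  omega

/-- a non-trivial decomposition of a four-path-free 3-graph -/
structure Sp (V : Finset α) (H A B R : Finset (Finset α)) : Prop where
  no : NoP4 H
  tri : Tri V H
  eq : H = A ∪ B ∪ R
  card : A.card + B.card + R.card = H.card
  ane : A.Nonempty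
  bne : B.Nonempty
  ab : ∀ a ∈ A, ∀ b ∈ B, Disjoint a b
  ar : ∀ a ∈ A, ∀ r ∈ R, ¬ Disjoint a r
  br : ∀ b ∈ B, ∀ r ∈ R, ¬ Disjoint b r

def bd (n : ℕ) : ℕ := if n = 8 then 24 else if n = 9 then 26 else 29

section
variable {V : Finset α} {H A B R : Finset (Finset α)}

theorem Sp.symm (S : Sp V H A B R) : Sp V H B A R :=
  ⟨S.no, S.tri, by rw [S.eq, union_comm A B], by rw [← S.card]; omega, S.bne, S.ane,
    fun b hb a ha => (S.ab a ha b hb).symm, S.br, S.ar⟩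

theorem Sp.Asub (S : Sp V H A B R) : A ⊆ H := by
  rw [S.eq]; intro x hx; simp [hx]

theorem Sp.Bsub (S : Sp V H A B R) : B ⊆ H := S.symm.Asub

theorem Sp.Rsub (S : Sp V H A B R) : R ⊆ H := by
  rw [S.eq]; intro x hx; simp [hx]

theorem tri_sup (hT : Tri V A) : Tri (A.sup id) A :=
  fun t ht => ⟨le_sup (f := id) ht, (hT t ht).2⟩

theorem Sp.supV (S : Sp V H A B R) : A.sup id ⊆ V :=
  Finset.sup_le fun t ht => (S.tri t (S.Asub ht)).1

theorem Sp.triA (S : Sp V H A B R) : Tri (A.sup id) A := tri_sup (S.tri.mono S.Asub)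

theorem Sp.triB (S : Sp V H A B R) : Tri (V \ A.sup id) B := by
  intro t ht
  obtain ⟨h1, h2⟩ := S.tri t (S.Bsub ht)
  refine ⟨fun z hz => mem_sdiff.2 ⟨h1 hz, fun hz' => ?_⟩, h2⟩
  rw [mem_sup] at hz'
  obtain ⟨a, ha, hza⟩ := hz'
  exact disjoint_left.1 (S.ab a ha t ht) hza hz

theorem Sp.cardU (S : Sp V H A B R) : (V \ A.sup id).card + (A.sup id).card = V.card :=
  card_sdiff_add_card_eq_card S.supV

theorem Sp.a3 (S : Sp V H A B R) : 3 ≤ (A.sup id).card := by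
  obtain ⟨e, he⟩ := S.ane
  rw [← (S.triA e he).2]
  exact card_le_card (S.triA e he).1

theorem Sp.u3 (S : Sp V H A B R) : 3 ≤ (V \ A.sup id).card := by
  obtain ⟨e, he⟩ := S.bne
  rw [← (S.triB e he).2]
  exact card_le_card (S.triB e he).1

theorem starA (hT : Tri V A) {i : α} (hi : ∀ a ∈ A, i ∈ a) (hiV : i ∈ V) :
    A.card ≤ (V.card - 1).choose 2 := by
  rw [← card_erase_of_mem hiV]
  refine card_star (y := i) fun t ht => ⟨(hT t ht).2, hi t ht, ?_⟩
  rw [insert_erase hiV]; exact (hT t ht).1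

theorem Sp.decomp (S : Sp V H A B R) {r : Finset α} (hr : r ∈ R) (hz : ∀ z ∈ r, ∃ t ∈ B, z ∉ t) :
    ∃ i, r = insert i (r \ A.sup id) ∧ (r \ A.sup id).card = 2 ∧ r \ A.sup id ⊆ V \ A.sup id ∧
      (∀ a ∈ A, i ∈ a) ∧ ∀ t ∈ B, ¬ Disjoint (r \ A.sup id) t := by
  obtain ⟨hrV, hr3⟩ := S.tri r (S.Rsub hr)
  have hc : ∀ t ∈ B, ¬ Disjoint (r \ A.sup id) t := by
    intro t ht
    obtain ⟨z, h1, h2⟩ := not_disjoint_iff.1 (S.br t ht r hr)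
    exact not_disjoint_iff.2 ⟨z, mem_sdiff.2 ⟨h2, (mem_sdiff.1 ((S.triB t ht).1 h1)).2⟩, h1⟩
  have h2 : 2 ≤ (r \ A.sup id).card := by
    by_contra hlt
    have h1 : (r \ A.sup id).card ≤ 1 := by omega
    obtain ⟨b, hb⟩ := S.bne
    obtain ⟨z, hz1, -⟩ := not_disjoint_iff.1 (hc b hb)
    obtain ⟨t, ht, hzt⟩ := hz z (mem_sdiff.1 hz1).1
    obtain ⟨z', hz2, hz3⟩ := not_disjoint_iff.1 (hc t ht)
    rw [card_le_one.1 h1 z hz1 z' hz2] at hzt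
    exact hzt hz3
  have hA : ∀ a ∈ A, ∃ z ∈ r ∩ A.sup id, z ∈ a := by
    intro a ha
    obtain ⟨z, h1, h2⟩ := not_disjoint_iff.1 (S.ar a ha r hr)
    exact ⟨z, mem_inter.2 ⟨h2, (S.triA a ha).1 h1⟩, h1⟩
  have h3 := card_sdiff_add_card_inter r (A.sup id)
  obtain ⟨e, he⟩ := S.ane
  obtain ⟨i, hi, -⟩ := hA e he
  have h4 : 0 < (r ∩ A.sup id).card := card_pos.2 ⟨i, hi⟩
  obtain ⟨j, hj⟩ := card_eq_one.1 (show (r ∩ A.sup id).card = 1 by omega)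
  refine ⟨j, ?_, by omega, sdiff_subset_sdiff hrV le_rfl, ?_, hc⟩
  · conv_lhs => rw [← sdiff_union_inter r (A.sup id), hj]
    rw [union_comm]; rfl
  · intro a ha
    obtain ⟨z, hz, hza⟩ := hA a ha
    rw [hj, mem_singleton] at hz
    exact hz ▸ hza

theorem case0 (S : Sp V H A B R) (h8 : 8 ≤ V.card) (h10 : V.card ≤ 10) (hR : R = ∅) :
    H.card ≤ bd V.card := by
  have h1 := card_triples S.triA
  have h2 := card_triples S.triB
  have h3 := S.cardU
  have h4 := S.a3
  have h5 := S.u3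
  have h6 := S.card
  have h7 : (A.sup id).card = 7 → A.card ≤ 28 := fun h => seven (S.no.mono S.Asub) S.triA h
  have h8 : (V \ A.sup id).card = 7 → B.card ≤ 28 := fun h => seven (S.no.mono S.Bsub) S.triB h
  rw [hR, card_empty] at h6
  generalize V.card = n at *
  generalize (A.sup id).card = a at *
  generalize (V \ A.sup id).card = b at *
  have hb : b = n - a := by omega
  subst hb
  have : a ≤ 7 := by omega
  unfold bd
  interval_cases n <;> interval_cases a <;> simp [Nat.choose] at * <;> omega

theorem case1 (S : Sp V H A B R) (h8 : 8 ≤ V.card) (h10 : V.card ≤ 10) (hR : R.Nonempty)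
    (hk : ∀ v, ∃ t ∈ B, v ∉ t) : H.card ≤ bd V.card := by
  obtain ⟨e, he⟩ := S.ane
  have he3 := (S.triA e he).2
  have heV := (S.triA e he).1
  have dec := fun r (hr : r ∈ R) => S.decomp hr (fun z _ => hk z)
  obtain ⟨U, hU⟩ : ∃ U, U = V \ A.sup id := ⟨_, rfl⟩
  obtain ⟨Q, hQ⟩ : ∃ Q, Q = R.image (fun r => r \ A.sup id) := ⟨_, rfl⟩
  have hQe : ∀ q ∈ Q, q.card = 2 ∧ q ⊆ U ∧ ∀ t ∈ B, ¬ Disjoint q t := by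
    intro q hq
    rw [hQ, mem_image] at hq
    obtain ⟨r, hr, rfl⟩ := hq
    obtain ⟨i, h1, h2, h3, h4, h5⟩ := dec r hr
    exact ⟨h2, hU ▸ h3, h5⟩
  have hQd : ∀ q ∈ Q, Disjoint q e := by
    intro q hq
    have := (hQe q hq).2.1
    rw [hU] at this
    exact (sdiff_disjoint.mono_left this).mono_right heV
  have hf : R.card ≤ ∑ q ∈ Q, wt R e q := by
    apply fiber
    intro r hr
    obtain ⟨i, h1, h2, h3, h4, h5⟩ := dec r hr
    exact ⟨hr, _, hQ ▸ mem_image_of_mem _ hr, i, h4 e he, h1⟩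
  have hU4 : 4 ≤ U.card := by
    by_contra hlt
    have : ∀ t ∈ B, t = U := fun t ht =>
      eq_of_subset_of_card_le (hU ▸ (S.triB t ht).1) (by rw [(S.triB t ht).2]; omega)
    obtain ⟨b, hb⟩ := S.bne
    obtain ⟨z, hz⟩ : b.Nonempty := card_pos.1 (by rw [(S.triB b hb).2]; omega)
    obtain ⟨t, ht, hzt⟩ := hk z
    rw [this t ht, ← this b hb] at hzt
    exact hzt hz
  have hcU := S.cardU
  have ha3 := S.a3
  rw [← hU] at hcU
  have key := covA (w := wt R e) (d := U.card - 2) (hU ▸ S.triB) hQe (by rw [hQ]; exact hR.image _) hk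
    (fun q hq q' hq' hd => wt_disj (S.no.mono S.Rsub) he3 (hQe q hq).1 (hQe q' hq').1 hd
      (hQd q hq) (hQd q' hq')) (by omega) (fun q hq => he3 ▸ wt_le) (by omega) (by omega) (by
        intro hd q hq
        obtain ⟨e', he', hne⟩ : ∃ e' ∈ A, ¬ e ⊆ e' := by
          by_contra hcon
          push Not at hcon
          have : ∀ a ∈ A, a = e := fun a ha =>
            (eq_of_subset_of_card_le (hcon a ha) (by rw [(S.triA a ha).2, he3])).symm
          have h1 : A.sup id ⊆ e := Finset.sup_le fun a ha => (this a ha).le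
          have := card_le_card h1
          omega
        have h1 : (e.filter fun i => insert i q ∈ R) ⊆ e ∩ e' := by
          intro i hi
          obtain ⟨hi, hiR⟩ := mem_filter.1 hi
          refine mem_inter.2 ⟨hi, ?_⟩
          obtain ⟨j, g1, g2, g3, g4, g5⟩ := dec _ hiR
          have hij : i ∈ insert j (insert i q \ A.sup id) := g1 ▸ mem_insert_self _ _
          rcases mem_insert.1 hij with rfl | h
          · exact g4 e' he'
          · exact absurd (heV hi) (mem_sdiff.1 h).2
        have h2 := card_le_card h1
        have h3 : (e ∩ e').card < e.card := card_lt_card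
          ⟨inter_subset_left, fun h => hne (h.trans inter_subset_right)⟩
        unfold wt; omega)
  obtain ⟨r, hr⟩ := hR
  obtain ⟨i, -, -, -, h4, -⟩ := dec r hr
  have hAc := starA S.triA h4 (heV (h4 e he))
  have hcard := S.card
  generalize V.card = n at *
  generalize (A.sup id).card = a at *
  generalize U.card = u at *
  have hu : u = n - a := by omega
  subst hu
  have : a ≤ 6 := by omega
  generalize ∑ q ∈ Q, wt R e q = s at *
  have hf' : H.card ≤ (a - 1).choose 2 + (B.card + s) := by omega
  clear hcard hf hAc dec
  unfold bd
  interval_cases n <;> interval_cases a <;> simp [Nat.choose] at * <;> omega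

end
end RP4

namespace RP4
variable {α : Type*} [DecidableEq α]
variable {V : Finset α} {H A B R : Finset (Finset α)}

theorem kernel_cases (hT : Tri V B) (hne : B.Nonempty) {v : α} (hv : ∀ t ∈ B, v ∈ t) :
    (∃ f, B = {f}) ∨ (2 ≤ B.card ∧ ∃ x y, x ≠ y ∧ (∀ t ∈ B, x ∈ t ∧ y ∈ t) ∧
      ∀ z, z ≠ x → z ≠ y → ∃ t ∈ B, z ∉ t) ∨ (∀ z, z ≠ v → ∃ t ∈ B, z ∉ t) := by
  by_cases h1 : ∀ z, z ≠ v → ∃ t ∈ B, z ∉ t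
  · exact Or.inr (Or.inr h1)
  push Not at h1
  obtain ⟨y, hyv, hy⟩ := h1
  by_cases h2 : ∀ z, z ≠ v → z ≠ y → ∃ t ∈ B, z ∉ t
  · refine Or.inr (Or.inl ⟨?_, v, y, hyv.symm, fun t ht => ⟨hv t ht, hy t ht⟩, h2⟩)
    obtain ⟨t, ht⟩ := hne
    obtain ⟨c, h3, h4, h5⟩ := triple_of_pair (hT t ht).2 (hv t ht) (hy t ht) hyv.symm
    obtain ⟨t', ht', hc⟩ := h2 c h3 h4
    refine one_lt_card.2 ⟨t, ht, t', ht', ?_⟩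
    rintro rfl
    rw [h5] at hc; simp at hc
  · left
    push Not at h2
    obtain ⟨z, hz1, hz2, hz⟩ := h2
    obtain ⟨t, ht⟩ := hne
    refine ⟨t, eq_singleton_iff_unique_mem.2 ⟨ht, ?_⟩⟩
    have : ∀ t ∈ B, t = {v, y, z} := by
      intro t ht
      symm
      apply eq_of_subset_of_card_le
      · intro u; simp only [mem_insert, mem_singleton]
        rintro (rfl | rfl | rfl)
        · exact hv _ ht
        · exact hy _ ht
        · exact hz _ ht
      · rw [(hT t ht).2, card_eq_three.2 ⟨v, y, z, hyv.symm, hz1.symm, hz2.symm, rfl⟩]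
    intro s hs
    rw [this s hs, this t ht]

theorem case_a {e f : Finset α} (S : Sp V H {e} {f} R) (h8 : 8 ≤ V.card) (h10 : V.card ≤ 10) :
    H.card ≤ bd V.card := by
  have h1 := S.tri e (S.Asub (by simp))
  have h2 := S.tri f (S.Bsub (by simp))
  have h3 := two_edges_bound (S.no.mono S.Rsub) (S.tri.mono S.Rsub) h1.1 h2.1 h1.2 h2.2
    (S.ab e (by simp) f (by simp)) (fun r hr => S.ar e (by simp) r hr)
    (fun r hr => S.br f (by simp) r hr) h8 h10
  have h4 := S.card
  simp only [card_singleton] at h4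
  unfold bd
  split_ifs <;> omega

theorem case_c_num {n w kx ky p g gx gy b s T G : ℕ} (h8 : 8 ≤ n) (h10 : n ≤ 10) (hw : w ≤ 3)
    (hkx : kx ≤ 1) (hky : ky ≤ 1) (hp : p ≤ 1)
    (hb : b ≤ g + gx + gy) (hg : g ≤ 1) (h1 : kx = 0 → gy ≤ n - 6) (h2 : kx = 1 → gy ≤ 1)
    (h3 : ky = 0 → gx ≤ n - 6) (h4 : ky = 1 → gx ≤ 1)
    (h5 : p = 1 → g = 0 ∧ gx ≤ 2 ∧ gy ≤ 2)
    (hs : s ≤ w * (1 + kx + ky) + min w (4 - w) * p) (hT : T ≤ 6 + (n - 6) * min 3 (4 - w))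
    (hG : G ≤ s) (hG' : n ≤ G + 6) : 1 + b + (3 + T + G) ≤ bd n := by
  unfold bd
  interval_cases w <;> interval_cases p <;> interval_cases kx <;> interval_cases ky <;>
    simp at h1 h2 h3 h4 h5 hs hT <;> split_ifs <;> omega

theorem case_c_R {e : Finset α} (S : Sp V H {e} B R) (v : α) (hve : v ∉ e) {G : Finset (Finset α)}
    {Z : Finset α} (hG : G = R.filter (fun r => v ∉ r)) (hZ : Z = (V \ e).erase v) :
    R.card ≤ 3 + ∑ z ∈ Z, wt R e {v, z} + G.card := by
  have he3 : e.card = 3 := (S.tri e (S.Asub (by simp))).2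
  have e0 : R.card ≤ (((powersetCard 2 e).image (insert v)).card) +
      ((Z.biUnion fun z => (e.filter fun i => (insert i {v, z} : Finset α) ∈ R).image fun i => (insert i {v, z} : Finset α)).card + G.card) := by
    have := card_le_list (F := R) [(powersetCard 2 e).image (insert v),
      Z.biUnion fun z => (e.filter fun i => (insert i {v, z} : Finset α) ∈ R).image fun i => (insert i {v, z} : Finset α), G] (by
      intro r hr
      by_cases hvr : v ∈ r
      · obtain ⟨i, hi, hir⟩ := not_disjoint_iff.1 (S.ar e (by simp) r hr)
        have hiv : v ≠ i := by rintro rfl; exact hve hi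
        obtain ⟨c, h1, h2, h3⟩ := triple_of_pair (S.tri r (S.Rsub hr)).2 hvr hir hiv
        by_cases hce : c ∈ e
        · refine ⟨_, List.mem_cons_self .., mem_image.2 ⟨{i, c}, ?_, h3.symm⟩⟩
          rw [mem_powersetCard]
          refine ⟨?_, Finset.card_pair h2.symm⟩
          intro z; simp only [mem_insert, mem_singleton]; rintro (rfl | rfl) <;> assumption
        · refine ⟨_, List.mem_cons_of_mem _ (List.mem_cons_self ..), ?_⟩
          have h4 : r = insert i {v, c} := by
            rw [h3]; exact Finset.insert_comm _ _ _
          simp only [mem_biUnion, mem_image, mem_filter]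
          refine ⟨c, ?_, i, ⟨hi, h4 ▸ hr⟩, h4.symm⟩
          rw [hZ, mem_erase, mem_sdiff]
          exact ⟨h1, (S.tri r (S.Rsub hr)).1 (h3 ▸ (by simp)), hce⟩
      · exact ⟨G, by simp, hG ▸ mem_filter.2 ⟨hr, hvr⟩⟩)
    simpa using this
  have e1 : ((powersetCard 2 e).image (insert v)).card ≤ 3 := by
    refine card_image_le.trans ?_
    rw [card_powersetCard, he3]; decide
  have e2 : (Z.biUnion fun z => (e.filter fun i => (insert i {v, z} : Finset α) ∈ R).image fun i => (insert i {v, z} : Finset α)).card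
    ≤ ∑ z ∈ Z, wt R e {v, z} := card_biUnion_le.trans (sum_le_sum fun q _ => card_image_le)
  omega

theorem case_c {e : Finset α} (S : Sp V H {e} B R) (h8 : 8 ≤ V.card) (h10 : V.card ≤ 10) {v : α}
    (hv : ∀ t ∈ B, v ∈ t) (hk : ∀ z, z ≠ v → ∃ t ∈ B, z ∉ t) :
    H.card ≤ bd V.card ∨ ∃ v, (H.filter fun t => v ∉ t).card + 6 ≤ V.card := by
  have hsup : ({e} : Finset (Finset α)).sup id = e := by simp
  have he3 : e.card = 3 := (S.tri e (S.Asub (by simp))).2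
  have heV : e ⊆ V := (S.tri e (S.Asub (by simp))).1
  have dec := fun r (hr : r ∈ R) (hvr : v ∉ r) => S.decomp hr
    (fun z hz => hk z (by rintro rfl; exact hvr hz))
  have tB := S.triB
  have hcU := S.cardU
  rw [hsup] at tB hcU
  simp only [hsup] at dec
  have hvU : v ∈ V \ e := by
    obtain ⟨b, hb⟩ := S.bne
    exact (tB b hb).1 (hv b hb)
  have hve : v ∉ e := (mem_sdiff.1 hvU).2
  obtain ⟨G, hG⟩ : ∃ G, G = R.filter (fun r => v ∉ r) := ⟨_, rfl⟩
  by_cases hoff : (H.filter fun t => v ∉ t).card + 6 ≤ V.card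
  · exact Or.inr ⟨v, hoff⟩
  left
  have hoff1 : (H.filter fun t => v ∉ t).card ≤ 1 + G.card := by
    have : (H.filter fun t => v ∉ t) ⊆ insert e G := by
      intro t ht
      obtain ⟨ht, hvt⟩ := mem_filter.1 ht
      rw [S.eq] at ht
      simp only [mem_union, mem_singleton] at ht
      rcases ht with (rfl | ht) | ht
      · simp
      · exact absurd (hv t ht) hvt
      · rw [mem_insert, hG]; exact Or.inr (mem_filter.2 ⟨ht, hvt⟩)
    have := (card_le_card this).trans (card_insert_le _ _)
    omega
  have hGne : G.Nonempty := card_pos.1 (by omega)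
  obtain ⟨Q, hQ⟩ : ∃ Q, Q = G.image (fun r => r \ e) := ⟨_, rfl⟩
  have hQe : ∀ q ∈ Q, q.card = 2 ∧ q ⊆ V \ e ∧ v ∉ q ∧ ∀ t ∈ B, ¬ Disjoint q t := by
    intro q hq
    rw [hQ, mem_image] at hq
    obtain ⟨r, hr, rfl⟩ := hq
    rw [hG] at hr
    obtain ⟨hr, hvr⟩ := mem_filter.1 hr
    obtain ⟨i, h1, h2, h3, h4, h5⟩ := dec r hr hvr
    exact ⟨h2, h3, fun h => hvr (mem_sdiff.1 h).1, h5⟩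
  have hQd : ∀ q ∈ Q, Disjoint q e := fun q hq => sdiff_disjoint.mono_left (hQe q hq).2.1
  have hf : G.card ≤ ∑ q ∈ Q, wt R e q := by
    apply fiber
    intro r hr
    have hr' := hr
    rw [hG] at hr
    obtain ⟨hr, hvr⟩ := mem_filter.1 hr
    obtain ⟨i, h1, h2, h3, h4, h5⟩ := dec r hr hvr
    exact ⟨hr, _, hQ ▸ mem_image_of_mem _ hr', i, h4 e (by simp), h1⟩
  have hNR := S.no.mono S.Rsub
  obtain ⟨q, hq, kx, ky, p, g, gx, gy, c1, c2, c3, c4, c5, c6, c7, c8, c9, c10, c11⟩ :=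
    covB (w := wt R e) (m := V.card - 4) tB hvU hv hQe (by rw [hQ]; exact hGne.image _) hk
      (fun q hq q' hq' hd => wt_disj hNR he3 (hQe q hq).1 (hQe q' hq').1 hd
      (hQd q hq) (hQd q' hq')) (by omega)
  obtain ⟨Z, hZ⟩ : ∃ Z, Z = (V \ e).erase v := ⟨_, rfl⟩
  have hZc : Z.card + 4 = V.card := by
    rw [hZ, card_erase_of_mem hvU]; omega
  have hqZ : q ⊆ Z := by
    intro z hz
    rw [hZ, mem_erase]
    exact ⟨by rintro rfl; exact (hQe q hq).2.2.1 hz, (hQe q hq).2.1 hz⟩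
  have hvZ : ∀ z ∈ Z, z ≠ v ∧ z ∉ e := by
    intro z hz
    rw [hZ, mem_erase, mem_sdiff] at hz
    exact ⟨hz.1, hz.2.2⟩
  -- sum of the weights of the pairs through v
  have hsum : ∑ z ∈ Z, wt R e {v, z} ≤ 6 + (V.card - 6) * min 3 (4 - wt R e q) := by
    rw [← sum_sdiff hqZ, add_comm]
    have e1 := sum_le_card_nsmul q (fun z => wt R e {v, z}) 3 (fun z _ => he3 ▸ wt_le)
    have e2 := sum_le_card_nsmul (Z \ q) (fun z => wt R e {v, z}) (min 3 (4 - wt R e q)) (by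
      intro z hz
      obtain ⟨hz, hzq⟩ := mem_sdiff.1 hz
      have h1 := wt_disj hNR he3 (Finset.card_pair (hvZ z hz).1.symm) (hQe q hq).1
        (by simp [hzq, (hQe q hq).2.2.1]) (by simp [hve, (hvZ z hz).2]) (hQd q hq)
      have h2 := wt_le (R := R) (e := e) (q := {v, z})
      rw [le_min_iff]; omega)
    have e3 : (Z \ q).card = V.card - 6 := by
      rw [card_sdiff_of_subset hqZ, (hQe q hq).1]; omega
    rw [e3] at e2
    rw [(hQe q hq).1] at e1
    exact add_le_add e1 e2
  have hRv := case_c_R S v hve hG hZ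
  have hcard := S.card
  rw [card_singleton] at hcard
  have hw : wt R e q ≤ 3 := he3 ▸ wt_le
  have := case_c_num h8 h10 hw c1 c2 c3 c4 c5 (fun h => (c6 h).trans (by omega)) c7
    (fun h => (c8 h).trans (by omega)) c9 (fun h => ⟨(c10 h).1, (c10 h).2.1, (c10 h).2.2.1⟩)
    c11 hsum hf (by omega)
  omega

end RP4

namespace RP4
variable {α : Type*} [DecidableEq α]
variable {V : Finset α} {H A B R : Finset (Finset α)}

theorem swp (i x j : α) : ({i, x, j} : Finset α) = {j, x, i} := by
  ext z; simp only [mem_insert, mem_singleton]; tauto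

theorem th_swap {i j x : α} : (th R i x {j}).card = (th R j x {i}).card := by
  have := swp i x j
  unfold th
  rw [filter_singleton, filter_singleton, this]
  split_ifs <;> simp

theorem gx_bound {F : Finset (Finset α)} {a b c x : α} {Z : Finset α} 
    (hx : x ≠ a ∧ x ≠ b ∧ x ≠ c)
    (h : ∀ r ∈ F, r ∈ R ∧ r.card = 3 ∧ x ∈ r ∧ r ⊆ insert x ({a, b, c} ∪ Z) ∧ ¬ Disjoint {a, b, c} r) :
    F.card ≤ (th R a x Z).card + (th R b x Z).card + (th R c x Z).card +
      (th R a x {b}).card + (th R a x {c}).card + (th R b x {c}).card := by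
  have im : ∀ (i : α) (S : Finset α), ((th R i x S).image fun z => ({i, x, z} : Finset α)).card ≤ (th R i x S).card :=
    fun i S => card_image_le
  have key := card_le_list (F := F) [(th R a x Z).image fun z => ({a, x, z} : Finset α),
    (th R b x Z).image fun z => ({b, x, z} : Finset α), (th R c x Z).image fun z => ({c, x, z} : Finset α),
    (th R a x {b}).image fun z => ({a, x, z} : Finset α), (th R a x {c}).image fun z => ({a, x, z} : Finset α),
    (th R b x {c}).image fun z => ({b, x, z} : Finset α)] (by
      intro r hr
      obtain ⟨h1, h2, h3, h4, h5⟩ := h r hr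
      obtain ⟨i, hi, hir⟩ := not_disjoint_iff.1 h5
      have hix : i ≠ x := by
        rintro rfl; simp [hx] at hi
      obtain ⟨z, hz1, hz2, rfl⟩ := triple_of_pair h2 hir h3 hix
      have hz := h4 (show z ∈ ({i, x, z} : Finset α) by simp)
      simp only [mem_insert, mem_singleton, mem_union] at hz
      have hzc : (z = a ∨ z = b ∨ z = c) ∨ z ∈ Z := hz.resolve_left hz2
      have sw := swp i x z
      simp only [mem_insert, mem_singleton] at hi
      simp only [List.mem_cons, List.not_mem_nil, or_false, exists_eq_or_imp, exists_eq_left, mem_image, mem_th, mem_singleton]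
      clear h h4 h5 hz hir h3 h2 hr
      rcases hzc with hzc | hzZ
      · rcases hi with rfl | rfl | rfl <;> rcases hzc with rfl | rfl | rfl <;>
          first
          | exact absurd rfl hz1
          | exact Or.inr (Or.inr (Or.inr (Or.inl ⟨_, ⟨rfl, h1⟩, rfl⟩)))
          | exact Or.inr (Or.inr (Or.inr (Or.inl ⟨_, ⟨rfl, sw ▸ h1⟩, sw.symm⟩)))
          | exact Or.inr (Or.inr (Or.inr (Or.inr (Or.inl ⟨_, ⟨rfl, h1⟩, rfl⟩))))
          | exact Or.inr (Or.inr (Or.inr (Or.inr (Or.inl ⟨_, ⟨rfl, sw ▸ h1⟩, sw.symm⟩))))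
          | exact Or.inr (Or.inr (Or.inr (Or.inr (Or.inr ⟨_, ⟨rfl, h1⟩, rfl⟩))))
          | exact Or.inr (Or.inr (Or.inr (Or.inr (Or.inr ⟨_, ⟨rfl, sw ▸ h1⟩, sw.symm⟩))))
      · rcases hi with rfl | rfl | rfl
        · exact Or.inl ⟨z, ⟨hzZ, h1⟩, rfl⟩
        · exact Or.inr (Or.inl ⟨z, ⟨hzZ, h1⟩, rfl⟩)
        · exact Or.inr (Or.inr (Or.inl ⟨z, ⟨hzZ, h1⟩, rfl⟩)))
  simp only [List.map_cons, List.map_nil, List.sum_cons, List.sum_nil] at key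
  have i1 := im a Z
  have i2 := im b Z
  have i3 := im c Z
  have i4 := im a {b}
  have i5 := im a {c}
  have i6 := im b {c}
  omega

theorem xy_bound (h : NoP4 R) {i j k x y : α} {Z : Finset α} (hij : i ≠ j) (hik : i ≠ k) (hjk : j ≠ k)
    (hx : x ≠ i ∧ x ≠ j ∧ x ≠ k ∧ x ≠ y) (hy : y ≠ i ∧ y ≠ j ∧ y ≠ k)
    (hZ : ∀ z ∈ Z, z ≠ i ∧ z ≠ j ∧ z ≠ k ∧ z ≠ x ∧ z ≠ y) (hZ3 : 3 ≤ Z.card) :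
    (th R i x Z).card + (th R i x {k}).card + ((th R j y Z).card + (th R j y {k}).card) ≤ Z.card + 2 ∧
    ((th R i x Z).card + (th R i x {k}).card + ((th R j y Z).card + (th R j y {k}).card) = Z.card + 2 →
      (th R i x Z).card + (th R i x {k}).card ≤ 1 ∨ (th R j y Z).card + (th R j y {k}).card ≤ 1) := by
  have hd : Disjoint Z {k} := by
    rw [disjoint_singleton_right]; intro hk; exact (hZ k hk).2.2.1 rfl
  rw [← th_union hd, ← th_union hd]
  have hc : (Z ∪ {k}).card = Z.card + 1 := by rw [card_union_of_disjoint hd, card_singleton]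
  have hne : ∀ z ∈ Z ∪ {k}, z ≠ i ∧ z ≠ x ∧ z ≠ j ∧ z ≠ y := by
    intro z hz
    rcases mem_union.1 hz with h | h
    · have := hZ z h; tauto
    · rw [mem_singleton] at h; subst h
      exact ⟨hik.symm, hx.2.2.1.symm, hjk.symm, hy.2.2.symm⟩
  have := sunflower_card h (a := i) (b := x) (c := j) (d := y) (S := Z ∪ {k})
    (X := th R i x (Z ∪ {k})) (Y := th R j y (Z ∪ {k})) hij hy.1.symm hx.2.1 hx.2.2.2 (by omega)
    (filter_subset _ _) (filter_subset _ _)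
    (fun z hz => ⟨hne z (mem_th.1 hz).1, (mem_th.1 hz).2⟩)
    (fun z hz => ⟨hne z (mem_th.1 hz).1, (mem_th.1 hz).2⟩)
  omega

theorem case_b_num {n a1 a2 a3 u12 u13 u23 b1 b2 b3 v12 v13 v23 : ℕ}
    (h1 : a1 + u13 + (b2 + v23) ≤ n) (h2 : a1 + u12 + (b3 + v23) ≤ n)
    (h3 : a2 + u23 + (b1 + v13) ≤ n) (h4 : a2 + u12 + (b3 + v13) ≤ n)
    (h5 : a3 + u23 + (b1 + v12) ≤ n) (h6 : a3 + u13 + (b2 + v12) ≤ n) :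
    a1 + a2 + a3 + u12 + u13 + u23 + (b1 + b2 + b3 + v12 + v13 + v23) ≤ 3 * n := by
  omega

theorem case_b_num2 {a1 a2 a3 u12 u13 u23 b1 b2 b3 v12 v13 v23 : ℕ}
    (h1 : a1 + u13 + (b2 + v23) ≤ 7) (h2 : a1 + u12 + (b3 + v23) ≤ 7)
    (h3 : a2 + u23 + (b1 + v13) ≤ 7) (h4 : a2 + u12 + (b3 + v13) ≤ 7)
    (h5 : a3 + u23 + (b1 + v12) ≤ 7) (h6 : a3 + u13 + (b2 + v12) ≤ 7)
    (g1 : a1 + u13 + (b2 + v23) = 7 → a1 + u13 ≤ 1 ∨ b2 + v23 ≤ 1)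
    (g2 : a1 + u12 + (b3 + v23) = 7 → a1 + u12 ≤ 1 ∨ b3 + v23 ≤ 1)
    (g3 : a2 + u23 + (b1 + v13) = 7 → a2 + u23 ≤ 1 ∨ b1 + v13 ≤ 1)
    (g4 : a2 + u12 + (b3 + v13) = 7 → a2 + u12 ≤ 1 ∨ b3 + v13 ≤ 1)
    (g5 : a3 + u23 + (b1 + v12) = 7 → a3 + u23 ≤ 1 ∨ b1 + v12 ≤ 1)
    (g6 : a3 + u13 + (b2 + v12) = 7 → a3 + u13 ≤ 1 ∨ b2 + v12 ≤ 1)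
    (U1 : u12 ≤ 1) (U2 : u13 ≤ 1) (U3 : u23 ≤ 1) (V1 : v12 ≤ 1) (V2 : v13 ≤ 1) (V3 : v23 ≤ 1) :
    a1 + a2 + a3 + u12 + u13 + u23 + (b1 + b2 + b3 + v12 + v13 + v23) ≤ 20 ∨
    a1 + a2 + a3 + u12 + u13 + u23 ≤ 3 ∨ b1 + b2 + b3 + v12 + v13 + v23 ≤ 3 := by
  by_contra hcon
  push Not at hcon
  obtain ⟨k1, k2, k3⟩ := hcon
  have e1 : a1 + u13 + (b2 + v23) = 7 := by omega
  have e2 : a1 + u12 + (b3 + v23) = 7 := by omega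
  have e3 : a2 + u23 + (b1 + v13) = 7 := by omega
  have e4 : a2 + u12 + (b3 + v13) = 7 := by omega
  have e5 : a3 + u23 + (b1 + v12) = 7 := by omega
  have e6 : a3 + u13 + (b2 + v12) = 7 := by omega
  rcases g1 e1 with f1 | f1 <;> rcases g3 e3 with f3 | f3 <;> rcases g5 e5 with f5 | f5 <;>
   rcases g2 e2 with f2 | f2 <;> rcases g4 e4 with f4 | f4 <;> rcases g6 e6 with f6 | f6 <;> omega

end RP4

namespace RP4
variable {α : Type*} [DecidableEq α]
variable {V : Finset α} {H A B R : Finset (Finset α)}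

theorem cov2 {Q : Finset (Finset α)} {x y : α} (hT : Tri V B) (hxy : x ≠ y)
    (hB : ∀ t ∈ B, x ∈ t ∧ y ∈ t) (h2 : 2 ≤ B.card)
    (hQ : ∀ q ∈ Q, q.card = 2 ∧ x ∉ q ∧ y ∉ q ∧ ∀ t ∈ B, ¬ Disjoint q t) :
    Q.card ≤ 1 ∧ (Q.Nonempty → B.card ≤ 2) := by
  have third : ∀ q ∈ Q, ∀ t ∈ B, ∀ z, t = {x, y, z} → z ∈ q := by
    intro q hq t ht z h
    obtain ⟨h1, h3, h4, h5⟩ := hQ q hq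
    have := h5 t ht
    rw [h] at this
    simpa [h3, h4] using this
  constructor
  · obtain ⟨t, ht, t', ht', hne⟩ := one_lt_card.1 h2
    obtain ⟨z, -, -, hz⟩ := triple_of_pair (hT t ht).2 (hB t ht).1 (hB t ht).2 hxy
    obtain ⟨z', -, -, hz'⟩ := triple_of_pair (hT t' ht').2 (hB t' ht').1 (hB t' ht').2 hxy
    have hzz : z ≠ z' := by rintro rfl; exact hne (hz.trans hz'.symm)
    have : ∀ q ∈ Q, q = {z, z'} := by
      intro q hq
      symm
      apply eq_of_subset_of_card_le
      · intro u; simp only [mem_insert, mem_singleton]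
        rintro (rfl | rfl)
        · exact third q hq t ht _ hz
        · exact third q hq t' ht' _ hz'
      · rw [(hQ q hq).1, Finset.card_pair hzz]
    rw [card_le_one]
    intro q hq q' hq'
    rw [this q hq, this q' hq']
  · rintro ⟨q, hq⟩
    rw [← (hQ q hq).1]
    refine card_pair hxy fun t ht => ⟨(hT t ht).2, (hB t ht).1, (hB t ht).2, ?_⟩
    obtain ⟨z, -, -, hz⟩ := triple_of_pair (hT t ht).2 (hB t ht).1 (hB t ht).2 hxy
    have := third q hq t ht z hz
    rw [hz]
    intro u; simp only [mem_insert, mem_singleton]; rintro (rfl | rfl | rfl) <;> simp [this]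

theorem case_b_R0 {e : Finset α} (S : Sp V H {e} B R) {x y : α} (hxy : x ≠ y)
    (hB : ∀ t ∈ B, x ∈ t ∧ y ∈ t) (hk : ∀ z, z ≠ x → z ≠ y → ∃ t ∈ B, z ∉ t) (h2 : 2 ≤ B.card)
    (hxe : x ∉ e) (hye : y ∉ e) :
    ((R.filter fun r => x ∉ r ∧ y ∉ r) = ∅ ∧ (R.filter fun r => x ∈ r ∧ y ∈ r).card ≤ 3) ∨
    (B.card ≤ 2 ∧ (R.filter fun r => x ∉ r ∧ y ∉ r).card + (R.filter fun r => x ∈ r ∧ y ∈ r).card ≤ 4) := by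
  have hsup : ({e} : Finset (Finset α)).sup id = e := by simp
  have he3 : e.card = 3 := (S.tri e (S.Asub (by simp))).2
  have hw : (R.filter fun r => x ∈ r ∧ y ∈ r).card ≤ wt R e {x, y} := by
    rw [← sum_singleton (fun q => wt R e q) {x, y}]
    apply fiber
    intro r hr
    obtain ⟨hr, hxr, hyr⟩ := mem_filter.1 hr
    refine ⟨hr, _, mem_singleton_self _, ?_⟩
    obtain ⟨i, hi, hir⟩ := not_disjoint_iff.1 (S.ar e (by simp) r hr)
    refine ⟨i, hi, ?_⟩
    symm
    apply eq_of_subset_of_card_le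
    · intro u; simp only [mem_insert, mem_singleton]; rintro (rfl | rfl | rfl) <;> assumption
    · rw [(S.tri r (S.Rsub hr)).2, card_insert_of_notMem, Finset.card_pair hxy]
      simp only [mem_insert, mem_singleton, not_or]
      exact ⟨by rintro rfl; exact hxe hi, by rintro rfl; exact hye hi⟩
  have hw3 : wt R e {x, y} ≤ 3 := he3 ▸ wt_le
  by_cases h0 : (R.filter fun r => x ∉ r ∧ y ∉ r) = ∅
  · left; exact ⟨h0, by omega⟩
  right
  have dec : ∀ r ∈ (R.filter fun r => x ∉ r ∧ y ∉ r), ∃ i, r = insert i (r \ e) ∧ (r \ e).card = 2 ∧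
      i ∈ e ∧ ∀ t ∈ B, ¬ Disjoint (r \ e) t := by
    intro r hr
    obtain ⟨hr, hxr, hyr⟩ := mem_filter.1 hr
    obtain ⟨i, g1, g2, g3, g4, g5⟩ := S.decomp hr (fun z hz => hk z (by rintro rfl; exact hxr hz)
      (by rintro rfl; exact hyr hz))
    rw [hsup] at g1 g2 g5
    exact ⟨i, g1, g2, g4 e (by simp), g5⟩
  obtain ⟨Q, hQ⟩ : ∃ Q, Q = (R.filter fun r => x ∉ r ∧ y ∉ r).image (fun r => r \ e) := ⟨_, rfl⟩
  have hQe : ∀ q ∈ Q, q.card = 2 ∧ x ∉ q ∧ y ∉ q ∧ ∀ t ∈ B, ¬ Disjoint q t := by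
    intro q hq
    rw [hQ, mem_image] at hq
    obtain ⟨r, hr, rfl⟩ := hq
    obtain ⟨i, h1, h2, h3, h4⟩ := dec r hr
    obtain ⟨hr, hxr, hyr⟩ := mem_filter.1 hr
    exact ⟨h2, fun h => hxr (mem_sdiff.1 h).1, fun h => hyr (mem_sdiff.1 h).1, h4⟩
  obtain ⟨c1, c2⟩ := cov2 (S.tri.mono S.Bsub) hxy hB h2 hQe
  obtain ⟨r, hr⟩ := nonempty_iff_ne_empty.2 h0
  have hq : r \ e ∈ Q := by rw [hQ]; exact mem_image_of_mem _ hr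
  refine ⟨c2 ⟨_, hq⟩, ?_⟩
  have hf : (R.filter fun r => x ∉ r ∧ y ∉ r).card ≤ ∑ q ∈ Q, wt R e q := by
    apply fiber
    intro r hr
    obtain ⟨i, h1, h2, h3, h4⟩ := dec r hr
    exact ⟨(mem_filter.1 hr).1, _, hQ ▸ mem_image_of_mem _ hr, i, h3, h1⟩
  have hQ1 : Q = {r \ e} := eq_singleton_iff_unique_mem.2 ⟨hq, fun q' hq' => card_le_one.1 c1 _ hq' _ hq⟩
  rw [hQ1, sum_singleton] at hf
  have := wt_disj (S.no.mono S.Rsub) he3 (Finset.card_pair hxy) (hQe _ hq).1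
    (by simp only [disjoint_insert_left, disjoint_singleton_left]; exact ⟨(hQe _ hq).2.1, (hQe _ hq).2.2.1⟩)
    (by simp [hxe, hye]) sdiff_disjoint
  omega

theorem case_b {e : Finset α} (S : Sp V H {e} B R) (h8 : 8 ≤ V.card) (h10 : V.card ≤ 10)
    {x y : α} (hxy : x ≠ y)
    (hB : ∀ t ∈ B, x ∈ t ∧ y ∈ t) (hk : ∀ z, z ≠ x → z ≠ y → ∃ t ∈ B, z ∉ t) (h2 : 2 ≤ B.card) :
    H.card ≤ bd V.card ∨ ∃ v, (H.filter fun t => v ∉ t).card + 6 ≤ V.card := by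
  have hsup : ({e} : Finset (Finset α)).sup id = e := by simp
  have he3 : e.card = 3 := (S.tri e (S.Asub (by simp))).2
  have tB := S.triB
  have hcU := S.cardU
  rw [hsup] at tB hcU
  obtain ⟨b, hb⟩ := S.bne
  have hxU : x ∈ V \ e := (tB b hb).1 (hB b hb).1
  have hyU : y ∈ V \ e := (tB b hb).1 (hB b hb).2
  have hxe : x ∉ e := (mem_sdiff.1 hxU).2
  have hye : y ∉ e := (mem_sdiff.1 hyU).2
  obtain ⟨Z, hZ⟩ : ∃ Z, Z = ((V \ e).erase x).erase y := ⟨_, rfl⟩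
  have hZc : Z.card + 5 = V.card := by
    rw [hZ, card_erase_of_mem (mem_erase.2 ⟨hxy.symm, hyU⟩), card_erase_of_mem hxU]; omega
  have hR0 := case_b_R0 S hxy hB hk h2 hxe hye
  have hBZ : B.card ≤ Z.card := by
    refine card_pair hxy fun t ht => ⟨(tB t ht).2, (hB t ht).1, (hB t ht).2, ?_⟩
    intro z hz
    rw [hZ, mem_insert, mem_insert, mem_erase, mem_erase]
    by_cases h1 : z = x
    · exact Or.inl h1
    · by_cases h2 : z = y
      · exact Or.inr (Or.inl h2)
      · exact Or.inr (Or.inr ⟨h2, h1, (tB t ht).1 hz⟩)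
  have hRs : R.card ≤ (R.filter fun r => x ∉ r ∧ y ∉ r).card + (R.filter fun r => x ∈ r ∧ y ∈ r).card +
      (R.filter fun r => x ∈ r ∧ y ∉ r).card + (R.filter fun r => y ∈ r ∧ x ∉ r).card := by
    have := card_le_list (F := R) [R.filter fun r => x ∉ r ∧ y ∉ r, R.filter fun r => x ∈ r ∧ y ∈ r,
      R.filter fun r => x ∈ r ∧ y ∉ r, R.filter fun r => y ∈ r ∧ x ∉ r] (by
        intro r hr
        simp only [List.mem_cons, List.not_mem_nil, or_false, exists_eq_or_imp, exists_eq_left, mem_filter, hr, true_and]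
        clear * -
        tauto)
    simp only [List.map_cons, List.map_nil, List.sum_cons, List.sum_nil] at this
    omega
  have hmem : ∀ r ∈ R, y ∉ r → r ⊆ insert x (e ∪ Z) := by
    intro r hr hyr z hz
    rw [hZ, mem_insert, mem_union, mem_erase, mem_erase, mem_sdiff]
    by_cases h1 : z = x
    · exact Or.inl h1
    · by_cases h2 : z ∈ e
      · exact Or.inr (Or.inl h2)
      · exact Or.inr (Or.inr ⟨by rintro rfl; exact hyr hz, h1, (S.tri r (S.Rsub hr)).1 hz, h2⟩)
  have hmem' : ∀ r ∈ R, x ∉ r → r ⊆ insert y (e ∪ Z) := by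
    intro r hr hyr z hz
    rw [hZ, mem_insert, mem_union, mem_erase, mem_erase, mem_sdiff]
    by_cases h1 : z = y
    · exact Or.inl h1
    · by_cases h2 : z ∈ e
      · exact Or.inr (Or.inl h2)
      · exact Or.inr (Or.inr ⟨h1, by rintro rfl; exact hyr hz, (S.tri r (S.Rsub hr)).1 hz, h2⟩)
  have hcard := S.card
  rw [card_singleton] at hcard
  -- off-degrees
  have off : ∀ u w, (∀ t ∈ B, u ∈ t ∧ w ∈ t) → (R.filter fun r => u ∉ r ∧ w ∉ r) = ∅ →
      (H.filter fun t => u ∉ t).card ≤ 1 + (R.filter fun r => w ∈ r ∧ u ∉ r).card := by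
    intro u w hB' h0
    have : (H.filter fun t => u ∉ t) ⊆ insert e (R.filter fun r => w ∈ r ∧ u ∉ r) := by
      intro t ht
      obtain ⟨ht, hvt⟩ := mem_filter.1 ht
      rw [S.eq] at ht
      simp only [mem_union, mem_singleton] at ht
      rcases ht with (rfl | ht) | ht
      · simp
      · exact absurd (hB' t ht).1 hvt
      · rw [mem_insert]
        refine Or.inr (mem_filter.2 ⟨ht, ?_, hvt⟩)
        by_contra hwt
        have : t ∈ (R.filter fun r => u ∉ r ∧ w ∉ r) := mem_filter.2 ⟨ht, hvt, hwt⟩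
        rw [h0] at this
        simp at this
    have := (card_le_card this).trans (card_insert_le _ _)
    omega
  have ox := off x y hB
  have oy := off y x (fun t ht => (hB t ht).symm)
  have hZm : ∀ z ∈ Z, z ≠ x ∧ z ≠ y ∧ z ∉ e := by
    intro z hz
    rw [hZ, mem_erase, mem_erase, mem_sdiff] at hz
    exact ⟨hz.2.1, hz.1, hz.2.2.2⟩
  have hNR := S.no.mono S.Rsub
  have hRe : ∀ r ∈ R, r.card = 3 ∧ ¬ Disjoint e r := fun r hr =>
    ⟨(S.tri r (S.Rsub hr)).2, S.ar e (by simp) r hr⟩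
  clear hk hsup tB hcU hb hxU hyU hZ off
  have hG : ((R.filter fun r => x ∈ r ∧ y ∉ r).card + (R.filter fun r => y ∈ r ∧ x ∉ r).card ≤ 3 * (Z.card + 2)) ∧
     (Z.card = 5 → (R.filter fun r => x ∈ r ∧ y ∉ r).card + (R.filter fun r => y ∈ r ∧ x ∉ r).card ≤ 20 ∨
      (R.filter fun r => x ∈ r ∧ y ∉ r).card ≤ 3 ∨ (R.filter fun r => y ∈ r ∧ x ∉ r).card ≤ 3) := by
    clear hR0 ox oy hcard hRs
    obtain ⟨a, b, c, hab, hac, hbc, rfl⟩ := card_eq_three.1 he3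
    simp only [mem_insert, mem_singleton, not_or] at hxe hye hZm
    obtain ⟨x1, x2, x3⟩ := hxe
    obtain ⟨y1, y2, y3⟩ := hye
    have gx := gx_bound (R := R) (F := R.filter fun r => x ∈ r ∧ y ∉ r) (Z := Z) ⟨x1, x2, x3⟩ (by
      intro r hr
      obtain ⟨hr, h1, h2⟩ := mem_filter.1 hr
      exact ⟨hr, (hRe r hr).1, h1, hmem r hr h2, (hRe r hr).2⟩)
    have gy := gx_bound (R := R) (F := R.filter fun r => y ∈ r ∧ x ∉ r) (Z := Z) ⟨y1, y2, y3⟩ (by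
      intro r hr
      obtain ⟨hr, h1, h2⟩ := mem_filter.1 hr
      exact ⟨hr, (hRe r hr).1, h1, hmem' r hr h2, (hRe r hr).2⟩)
    have hZ3 : 3 ≤ Z.card := by omega
    have m1 := xy_bound hNR (i := a) (j := b) (k := c) (x := x) (y := y) (Z := Z) hab hac hbc
      ⟨x1, x2, x3, hxy⟩ ⟨y1, y2, y3⟩ (fun z hz => by
        obtain ⟨q1, q2, q3, q4, q5⟩ := hZm z hz; exact ⟨q3, q4, q5, q1, q2⟩) hZ3
    have m2 := xy_bound hNR (i := a) (j := c) (k := b) (x := x) (y := y) (Z := Z) hac hab hbc.symm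
      ⟨x1, x3, x2, hxy⟩ ⟨y1, y3, y2⟩ (fun z hz => by
        obtain ⟨q1, q2, q3, q4, q5⟩ := hZm z hz; exact ⟨q3, q5, q4, q1, q2⟩) hZ3
    have m3 := xy_bound hNR (i := b) (j := a) (k := c) (x := x) (y := y) (Z := Z) hab.symm hbc hac
      ⟨x2, x1, x3, hxy⟩ ⟨y2, y1, y3⟩ (fun z hz => by
        obtain ⟨q1, q2, q3, q4, q5⟩ := hZm z hz; exact ⟨q4, q3, q5, q1, q2⟩) hZ3
    have m4 := xy_bound hNR (i := b) (j := c) (k := a) (x := x) (y := y) (Z := Z) hbc hab.symm hac.symm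
      ⟨x2, x3, x1, hxy⟩ ⟨y2, y3, y1⟩ (fun z hz => by
        obtain ⟨q1, q2, q3, q4, q5⟩ := hZm z hz; exact ⟨q4, q5, q3, q1, q2⟩) hZ3
    have m5 := xy_bound hNR (i := c) (j := a) (k := b) (x := x) (y := y) (Z := Z) hac.symm hbc.symm hab
      ⟨x3, x1, x2, hxy⟩ ⟨y3, y1, y2⟩ (fun z hz => by
        obtain ⟨q1, q2, q3, q4, q5⟩ := hZm z hz; exact ⟨q5, q3, q4, q1, q2⟩) hZ3
    have m6 := xy_bound hNR (i := c) (j := b) (k := a) (x := x) (y := y) (Z := Z) hbc.symm hac.symm hab.symm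
      ⟨x3, x2, x1, hxy⟩ ⟨y3, y2, y1⟩ (fun z hz => by
        obtain ⟨q1, q2, q3, q4, q5⟩ := hZm z hz; exact ⟨q5, q4, q3, q1, q2⟩) hZ3
    have w1 : ∀ i u j, (th R i u {j}).card ≤ 1 := fun i u j => th_card_le.trans (by simp)
    have t1 := w1 a x b
    have t2 := w1 a x c
    have t3 := w1 b x c
    have t4 := w1 a y b
    have t5 := w1 a y c
    have t6 := w1 b y c
    rw [th_swap (i := b) (j := a) (x := x)] at m4
    rw [th_swap (i := b) (j := a) (x := y)] at m6
    rw [th_swap (i := c) (j := b) (x := y)] at m2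
    rw [th_swap (i := c) (j := a) (x := y)] at m4
    rw [th_swap (i := c) (j := b) (x := x)] at m5
    rw [th_swap (i := c) (j := a) (x := x)] at m6
    generalize Z.card = n at *
    constructor
    · have := case_b_num m1.1 m2.1 m3.1 m4.1 m5.1 m6.1
      omega
    · rintro rfl
      have := case_b_num2 m1.1 m2.1 m3.1 m4.1 m5.1 m6.1 m1.2 m2.2 m3.2 m4.2 m5.2 m6.2 t1 t2 t3 t4 t5 t6
      omega
  obtain ⟨hG1, hG2⟩ := hG
  by_cases hfin : H.card ≤ bd V.card
  · exact Or.inl hfin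
  right
  have hbd : bd V.card + 1 ≤ H.card := by omega
  unfold bd at hbd
  rcases hR0 with ⟨r1, r2⟩ | ⟨r1, r2⟩
  · rw [r1, card_empty] at hRs
    have h5 : Z.card = 5 := by
      split_ifs at hbd <;> omega
    have hV : V.card = 10 := by omega
    rw [hV] at hbd
    simp at hbd
    rcases hG2 h5 with h | h | h
    · omega
    · have := oy (by rw [← r1]; congr 1; ext r; exact and_comm)
      exact ⟨y, by omega⟩
    · exact ⟨x, by have := ox r1; omega⟩
  · exfalso
    split_ifs at hbd <;> omega

end RP4

namespace RP4
variable {α : Type*} [DecidableEq α]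
variable {V : Finset α} {H A B R : Finset (Finset α)}

theorem side1 (S : Sp V H A B R) {v : α} {K : Finset α} (hK : ∀ i, (∀ a ∈ A, i ∈ a) → i ∈ K)
    (hK2 : K.card ≤ 2) (hv : ∀ t ∈ B, v ∈ t) (hk : ∀ z, z ≠ v → ∃ t ∈ B, z ∉ t) {m : ℕ}
    (hm : (V \ A.sup id).card = m + 1) :
    (R.filter fun r => v ∉ r).card = 0 ∨ ∃ kx ky p g gx gy : ℕ, kx ≤ 1 ∧ ky ≤ 1 ∧ p ≤ 1 ∧
      B.card ≤ g + gx + gy ∧ g ≤ 1 ∧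
      (kx = 0 → gy ≤ m - 2) ∧ (kx = 1 → gy ≤ 1) ∧ (ky = 0 → gx ≤ m - 2) ∧ (ky = 1 → gx ≤ 1) ∧
      (p = 1 → g = 0 ∧ gx ≤ 2 ∧ gy ≤ 2 ∧ 4 ≤ m) ∧
      (R.filter fun r => v ∉ r).card ≤ K.card * (1 + kx + ky + p) := by
  obtain ⟨G, hG⟩ : ∃ G, G = R.filter (fun r => v ∉ r) := ⟨_, rfl⟩
  rw [← hG]
  rcases G.eq_empty_or_nonempty with h0 | hGne
  · left; rw [h0, card_empty]
  right
  have dec := fun r (hr : r ∈ R) (hvr : v ∉ r) => S.decomp hr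
    (fun z hz => hk z (by rintro rfl; exact hvr hz))
  have hvU : v ∈ V \ A.sup id := by
    obtain ⟨b, hb⟩ := S.bne
    exact (S.triB b hb).1 (hv b hb)
  obtain ⟨Q, hQ⟩ : ∃ Q, Q = G.image (fun r => r \ A.sup id) := ⟨_, rfl⟩
  have hQe : ∀ q ∈ Q, q.card = 2 ∧ q ⊆ V \ A.sup id ∧ v ∉ q ∧ ∀ t ∈ B, ¬ Disjoint q t := by
    intro q hq
    rw [hQ, mem_image] at hq
    obtain ⟨r, hr, rfl⟩ := hq
    rw [hG] at hr
    obtain ⟨hr, hvr⟩ := mem_filter.1 hr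
    obtain ⟨i, h1, h2, h3, h4, h5⟩ := dec r hr hvr
    exact ⟨h2, h3, fun h => hvr (mem_sdiff.1 h).1, h5⟩
  have hf : G.card ≤ ∑ q ∈ Q, wt R K q := by
    apply fiber
    intro r hr
    have hr' := hr
    rw [hG] at hr
    obtain ⟨hr, hvr⟩ := mem_filter.1 hr
    obtain ⟨i, h1, h2, h3, h4, h5⟩ := dec r hr hvr
    exact ⟨hr, _, hQ ▸ mem_image_of_mem _ hr', i, hK i h4, h1⟩
  obtain ⟨q, hq, kx, ky, p, g, gx, gy, c1, c2, c3, c4, c5, c6, c7, c8, c9, c10, c11⟩ :=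
    covB (w := fun _ => K.card) S.triB hvU hv hQe (by rw [hQ]; exact hGne.image _) hk
      (by intros; omega) hm
  refine ⟨kx, ky, p, g, gx, gy, c1, c2, c3, c4, c5, c6, c7, c8, c9, c10, ?_⟩
  have h1 : ∑ q ∈ Q, wt R K q ≤ ∑ q ∈ Q, K.card := sum_le_sum fun q _ => wt_le
  have h2 : min K.card (4 - K.card) = K.card := by omega
  rw [h2] at c11
  calc G.card ≤ _ := hf.trans (h1.trans c11)
    _ = _ := by ring

theorem side2 (S : Sp V H A B R) {x y : α} {K : Finset α} (hK : ∀ i, (∀ a ∈ A, i ∈ a) → i ∈ K)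
    (hxy : x ≠ y) (hB : ∀ t ∈ B, x ∈ t ∧ y ∈ t) (hk : ∀ z, z ≠ x → z ≠ y → ∃ t ∈ B, z ∉ t)
    (h2 : 2 ≤ B.card) :
    (R.filter fun r => x ∉ r ∧ y ∉ r).card ≤ K.card ∧
      (0 < (R.filter fun r => x ∉ r ∧ y ∉ r).card → B.card ≤ 2) := by
  obtain ⟨G, hG⟩ : ∃ G, G = R.filter (fun r => x ∉ r ∧ y ∉ r) := ⟨_, rfl⟩
  rw [← hG]
  have dec := fun r (hr : r ∈ R) (hxr : x ∉ r) (hyr : y ∉ r) => S.decomp hr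
    (fun z hz => hk z (by rintro rfl; exact hxr hz) (by rintro rfl; exact hyr hz))
  obtain ⟨Q, hQ⟩ : ∃ Q, Q = G.image (fun r => r \ A.sup id) := ⟨_, rfl⟩
  have hQe : ∀ q ∈ Q, q.card = 2 ∧ x ∉ q ∧ y ∉ q ∧ ∀ t ∈ B, ¬ Disjoint q t := by
    intro q hq
    rw [hQ, mem_image] at hq
    obtain ⟨r, hr, rfl⟩ := hq
    rw [hG] at hr
    obtain ⟨hr, hxr, hyr⟩ := mem_filter.1 hr
    obtain ⟨i, h1, h2, h3, h4, h5⟩ := dec r hr hxr hyr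
    exact ⟨h2, fun h => hxr (mem_sdiff.1 h).1, fun h => hyr (mem_sdiff.1 h).1, h5⟩
  have hf : G.card ≤ ∑ q ∈ Q, wt R K q := by
    apply fiber
    intro r hr
    have hr' := hr
    rw [hG] at hr
    obtain ⟨hr, hxr, hyr⟩ := mem_filter.1 hr
    obtain ⟨i, h1, h2, h3, h4, h5⟩ := dec r hr hxr hyr
    exact ⟨hr, _, hQ ▸ mem_image_of_mem _ hr', i, hK i h4, h1⟩
  obtain ⟨c1, c2⟩ := cov2 (S.tri.mono S.Bsub) hxy hB h2 hQe
  have h1 : ∑ q ∈ Q, wt R K q ≤ ∑ q ∈ Q, K.card := sum_le_sum fun q _ => wt_le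
  rw [sum_const, smul_eq_mul] at h1
  constructor
  · have := Nat.mul_le_mul_right K.card c1
    omega
  · intro h
    apply c2
    rw [hQ]
    exact (card_pos.1 h).image _

theorem four {U : Finset α} (hT : Tri U B) {v : α} (hne : B.Nonempty)
    (hk : ∀ z, z ≠ v → ∃ t ∈ B, z ∉ t) : 4 ≤ U.card := by
  by_contra hlt
  have hU : ∀ t ∈ B, t = U := fun t ht =>
    eq_of_subset_of_card_le (hT t ht).1 (by rw [(hT t ht).2]; omega)
  obtain ⟨b, hb⟩ := hne
  have : 1 < b.card := by rw [(hT b hb).2]; omega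
  obtain ⟨z, hz, hzv⟩ := exists_mem_ne this v
  obtain ⟨t, ht, hzt⟩ := hk z hzv
  rw [hU t ht, ← hU b hb] at hzt
  exact hzt hz

theorem pairs_le {U : Finset α} (hT : Tri U B) {x y : α} (hxy : x ≠ y) (hne : B.Nonempty)
    (hB : ∀ t ∈ B, x ∈ t ∧ y ∈ t) : B.card + 2 ≤ U.card := by
  obtain ⟨b, hb⟩ := hne
  have hx := (hT b hb).1 (hB b hb).1
  have hy := (hT b hb).1 (hB b hb).2
  have h1 : B.card ≤ ((U.erase x).erase y).card := by
    refine card_pair hxy fun t ht => ⟨(hT t ht).2, (hB t ht).1, (hB t ht).2, ?_⟩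
    intro z hz
    rw [mem_insert, mem_insert, mem_erase, mem_erase]
    have := (hT t ht).1 hz
    clear * - this
    tauto
  have h3 : 3 ≤ U.card := (hT b hb).2 ▸ card_le_card (hT b hb).1
  rw [card_erase_of_mem (mem_erase.2 ⟨hxy.symm, hy⟩), card_erase_of_mem hx] at h1
  omega

theorem case_d11_num {n a b cA cB cR RA RB RR h : ℕ} (h8 : 8 ≤ n) (h10 : n ≤ 10) (ha : 4 ≤ a) (hb : 4 ≤ b)
    (hab : b + a = n) (hA : cA ≤ (a - 1).choose 2) (hB : cB ≤ (b - 1).choose 2)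
    (h1 : RA ≤ 4) (h2 : RB ≤ 4) (h3 : RR + 2 ≤ n) (h4 : cR ≤ RA + RB + RR) (hh : cA + cB + cR = h) :
    h ≤ bd n := by
  obtain rfl : b = n - a := by omega
  have : a ≤ 6 := by omega
  unfold bd
  interval_cases n <;> interval_cases a <;> simp [Nat.choose] at * <;> omega

theorem case_d11 (S : Sp V H A B R) (h8 : 8 ≤ V.card) (h10 : V.card ≤ 10) {u v : α}
    (hu : ∀ t ∈ A, u ∈ t) (hku : ∀ z, z ≠ u → ∃ t ∈ A, z ∉ t)
    (hv : ∀ t ∈ B, v ∈ t) (hkv : ∀ z, z ≠ v → ∃ t ∈ B, z ∉ t) : H.card ≤ bd V.card := by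
  have key : ∀ {A B : Finset (Finset α)} {u v : α}, Sp V H A B R → (∀ z, z ≠ u → ∃ t ∈ A, z ∉ t) →
      (∀ t ∈ B, v ∈ t) → (∀ z, z ≠ v → ∃ t ∈ B, z ∉ t) → (R.filter fun r => v ∉ r).card ≤ 4 := by
    intro A B u v S hku hv hkv
    have := S.u3
    rcases side1 (m := (V \ A.sup id).card - 1) (K := {u}) S (by
      intro i hi
      by_contra hne
      obtain ⟨t, ht, hit⟩ := hku i (by simpa using hne)
      exact hit (hi t ht)) (by simp) hv hkv (by omega) with h | h
    · omega
    · obtain ⟨kx, ky, p, g, gx, gy, c1, c2, c3, c4, c5, c6, c7, c8, c9, c10, c11⟩ := h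
      rw [card_singleton] at c11
      omega
  have hRA := key S hku hv hkv
  have hRB := key S.symm hkv hu hku
  obtain ⟨e, he⟩ := S.ane
  obtain ⟨f, hf⟩ := S.bne
  have huv : u ≠ v := by
    rintro rfl
    exact disjoint_left.1 (S.ab e he f hf) (hu e he) (hv f hf)
  have huA := (S.triA e he).1 (hu e he)
  have hvB := (S.triB f hf).1 (hv f hf)
  have hRR : (R.filter fun r => u ∈ r ∧ v ∈ r).card + 2 ≤ V.card := by
    by_cases hne : (R.filter fun r => u ∈ r ∧ v ∈ r).Nonempty
    · refine pairs_le (S.tri.mono ((filter_subset _ _).trans S.Rsub)) huv hne ?_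
      intro t ht
      exact (mem_filter.1 ht).2
    · rw [not_nonempty_iff_eq_empty.1 hne, card_empty]; omega
  have hRs : R.card ≤ (R.filter fun r => v ∉ r).card + (R.filter fun r => u ∉ r).card +
      (R.filter fun r => u ∈ r ∧ v ∈ r).card := by
    have := card_le_list (F := R) [R.filter fun r => v ∉ r, R.filter fun r => u ∉ r,
      R.filter fun r => u ∈ r ∧ v ∈ r] (by
        intro r hr
        simp only [List.mem_cons, List.not_mem_nil, or_false, exists_eq_or_imp, exists_eq_left, mem_filter, hr, true_and]
        clear * -
        tauto)
    simp only [List.map_cons, List.map_nil, List.sum_cons, List.sum_nil] at this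
    omega
  exact case_d11_num h8 h10 (four S.triA S.ane hku) (four S.triB S.bne hkv) S.cardU
    (starA S.triA hu huA) (starA S.triB hv hvB) hRA hRB hRR hRs S.card

theorem case_d12_num {n a m cA cB cR R0 R1 R2 h : ℕ} (h8 : 8 ≤ n) (h10 : n ≤ 10) (hm : 3 ≤ m)
    (hab : m + 1 + a = n) (hA : cA + 2 ≤ a) (hA2 : 2 ≤ cA) (hB : cB ≤ m.choose 2)
    (h1 : R1 ≤ 1) (h1' : 0 < R1 → cA ≤ 2) (h2 : R2 + 5 ≤ 2 * n)
    (h0 : R0 = 0 ∨ ∃ kx ky p g gx gy : ℕ, kx ≤ 1 ∧ ky ≤ 1 ∧ p ≤ 1 ∧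
      cB ≤ g + gx + gy ∧ g ≤ 1 ∧
      (kx = 0 → gy ≤ m - 2) ∧ (kx = 1 → gy ≤ 1) ∧ (ky = 0 → gx ≤ m - 2) ∧ (ky = 1 → gx ≤ 1) ∧
      (p = 1 → g = 0 ∧ gx ≤ 2 ∧ gy ≤ 2 ∧ 4 ≤ m) ∧
      R0 ≤ 2 * (1 + kx + ky + p)) (h4 : cR ≤ R0 + R1 + R2) (hh : cA + cB + cR = h) :
    h ≤ bd n := by
  obtain rfl : a = n - (m + 1) := by omega
  have : m ≤ 5 := by omega
  unfold bd
  rcases h0 with h0 | h0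
  · interval_cases n <;> interval_cases m <;> simp [Nat.choose] at * <;> omega
  · obtain ⟨kx, ky, p, g, gx, gy, c1, c2, c3, c4, c5, c6, c7, c8, c9, c10, c11⟩ := h0
    have hc : cB ≤ 3 ∨ 4 ≤ m := by
      by_cases h : m = 3
      · subst h; left; simpa [Nat.choose] using hB
      · right; omega
    have : cB + R0 ≤ 10 := by
      clear hB
      interval_cases kx <;> interval_cases ky <;> interval_cases p <;> omega
    have : m = 3 → cB + R0 ≤ 9 := by
      clear hB
      intro hm
      interval_cases kx <;> interval_cases ky <;> interval_cases p <;> omega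
    clear hB
    split_ifs <;> omega

theorem case_d12 (S : Sp V H A B R) (h8 : 8 ≤ V.card) (h10 : V.card ≤ 10) {x y v : α}
    (hxy : x ≠ y) (hA : ∀ t ∈ A, x ∈ t ∧ y ∈ t) (hk : ∀ z, z ≠ x → z ≠ y → ∃ t ∈ A, z ∉ t)
    (h2 : 2 ≤ A.card)
    (hv : ∀ t ∈ B, v ∈ t) (hkv : ∀ z, z ≠ v → ∃ t ∈ B, z ∉ t) : H.card ≤ bd V.card := by
  have hf := four S.triB S.bne hkv
  obtain ⟨m, hm⟩ : ∃ m, (V \ A.sup id).card = m + 1 := ⟨_, (Nat.sub_add_cancel (by omega)).symm⟩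
  have h0 := side1 (K := {x, y}) S (by
    intro i hi
    by_contra hne
    simp only [mem_insert, mem_singleton, not_or] at hne
    obtain ⟨t, ht, hit⟩ := hk i hne.1 hne.2
    exact hit (hi t ht)) card_le_two hv hkv hm
  obtain ⟨h1, h1'⟩ := side2 (K := {v}) S.symm (by
    intro i hi
    by_contra hne
    obtain ⟨t, ht, hit⟩ := hkv i (by simpa using hne)
    exact hit (hi t ht)) hxy hA hk h2
  rw [card_singleton] at h1
  rw [Finset.card_pair hxy] at h0
  obtain ⟨e, he⟩ := S.ane
  obtain ⟨f, hf'⟩ := S.bne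
  have hvB := (S.triB f hf').1 (hv f hf')
  have hvV := (mem_sdiff.1 hvB).1
  have hxV := (S.tri e (S.Asub he)).1 (hA e he).1
  have hyV := (S.tri e (S.Asub he)).1 (hA e he).2
  have hvx : x ≠ v := by
    rintro rfl
    exact disjoint_left.1 (S.ab e he f hf') (hA e he).1 (hv f hf')
  have hvy : y ≠ v := by
    rintro rfl
    exact disjoint_left.1 (S.ab e he f hf') (hA e he).2 (hv f hf')
  have hR2 : (R.filter fun r => v ∈ r ∧ (x ∈ r ∨ y ∈ r)).card + 5 ≤ 2 * V.card := by
    have := card_hit1 (G := (R.filter fun r => v ∈ r ∧ (x ∈ r ∨ y ∈ r)).image fun t => t.erase v)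
      (S := V.erase v) (mem_erase.2 ⟨hvx, hxV⟩) (mem_erase.2 ⟨hvy, hyV⟩) hxy (by
        intro g hg
        obtain ⟨r, hr, rfl⟩ := mem_image.1 hg
        obtain ⟨hr, h1, h2⟩ := mem_filter.1 hr
        refine ⟨by rw [card_erase_of_mem h1, (S.tri r (S.Rsub hr)).2],
          erase_subset_erase _ (S.tri r (S.Rsub hr)).1, ?_⟩
        exact h2.imp (fun h => mem_erase.2 ⟨hvx, h⟩) (fun h => mem_erase.2 ⟨hvy, h⟩))
    rw [link_card fun t ht => (mem_filter.1 ht).2.1, card_erase_of_mem hvV] at this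
    omega
  have hRs : R.card ≤ (R.filter fun r => v ∉ r).card + (R.filter fun r => x ∉ r ∧ y ∉ r).card +
      (R.filter fun r => v ∈ r ∧ (x ∈ r ∨ y ∈ r)).card := by
    have := card_le_list (F := R) [R.filter fun r => v ∉ r, R.filter fun r => x ∉ r ∧ y ∉ r,
      R.filter fun r => v ∈ r ∧ (x ∈ r ∨ y ∈ r)] (by
        intro r hr
        simp only [List.mem_cons, List.not_mem_nil, or_false, exists_eq_or_imp, exists_eq_left, mem_filter, hr, true_and]
        clear * -
        tauto)
    simp only [List.map_cons, List.map_nil, List.sum_cons, List.sum_nil] at this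
    omega
  have hst := starA S.triB hv hvB
  rw [hm, Nat.add_sub_cancel] at hst
  exact case_d12_num h8 h10 (by omega) (hm ▸ S.cardU) (pairs_le S.triA hxy S.ane hA) h2 hst h1 h1' hR2 h0
    hRs S.card

end RP4

namespace RP4
variable {α : Type*} [DecidableEq α]
variable {V : Finset α} {H A B R : Finset (Finset α)}

theorem d22_R (h : NoP4 R) (hT : Tri V R) {a b c d : α} (hab : a ≠ b) (hcd : c ≠ d)
    (hac : a ≠ c) (had : a ≠ d) (hbc : b ≠ c) (hbd : b ≠ d) {Z : Finset α} (hZ3 : 3 ≤ Z.card)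
    (hZ : Z = V \ {a, b, c, d}) :
    (R.filter fun r => (a ∈ r ∨ b ∈ r) ∧ (c ∈ r ∨ d ∈ r)).card ≤ 2 * (Z.card + 1) + 4 := by
  have hZm : ∀ z ∈ Z, z ≠ a ∧ z ≠ b ∧ z ≠ c ∧ z ≠ d := by
    intro z hz
    rw [hZ, mem_sdiff] at hz
    simpa using hz.2
  have key : ∀ p q p' q', p ≠ q → p' ≠ q' → p ≠ p' → p ≠ q' → q ≠ p' → q ≠ q' →
      (∀ z ∈ Z, z ≠ p ∧ z ≠ q ∧ z ≠ p' ∧ z ≠ q') →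
      (th R p q Z).card + (th R p' q' Z).card ≤ Z.card + 1 := by
    intro p q p' q' _ _ h1 h2 h3 h4 h5
    refine (sunflower_card h h1 h2 h3 h4 hZ3 (X := th R p q Z) (Y := th R p' q' Z)
      (filter_subset _ _) (filter_subset _ _) ?_ ?_).1
    · intro z hz
      exact ⟨h5 z (mem_th.1 hz).1, (mem_th.1 hz).2⟩
    · intro z hz
      exact ⟨h5 z (mem_th.1 hz).1, (mem_th.1 hz).2⟩
  have k1 := key a c b d hac hbd hab had hbc.symm hcd (fun z hz => by
    have := hZm z hz; exact ⟨this.1, this.2.2.1, this.2.1, this.2.2.2⟩)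
  have k2 := key a d b c had hbc hab hac hbd.symm hcd.symm (fun z hz => by
    have := hZm z hz; exact ⟨this.1, this.2.2.2, this.2.1, this.2.2.1⟩)
  have k4 : (powersetCard 3 ({a, b, c, d} : Finset α)).card ≤ 4 := by
    rw [card_powersetCard]
    have h4 : ({a, b, c, d} : Finset α).card = 4 := by
      rw [card_insert_of_notMem, card_insert_of_notMem, Finset.card_pair hcd] <;>
        simp [hab, hac, had, hbc, hbd]
    rw [h4]; decide
  have im : ∀ p q, ((th R p q Z).image fun z => ({p, q, z} : Finset α)).card ≤ (th R p q Z).card :=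
    fun p q => card_image_le
  have := card_le_list (F := R.filter fun r => (a ∈ r ∨ b ∈ r) ∧ (c ∈ r ∨ d ∈ r))
    [powersetCard 3 {a, b, c, d}, (th R a c Z).image fun z => {a, c, z},
     (th R a d Z).image fun z => {a, d, z}, (th R b c Z).image fun z => {b, c, z},
     (th R b d Z).image fun z => {b, d, z}] (by
      intro r hr
      obtain ⟨hr, h1, h2⟩ := mem_filter.1 hr
      obtain ⟨hrV, hr3⟩ := hT r hr
      simp only [List.mem_cons, List.not_mem_nil, or_false, exists_eq_or_imp, exists_eq_left]
      by_cases hs : r ⊆ {a, b, c, d}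
      · exact Or.inl (mem_powersetCard.2 ⟨hs, hr3⟩)
      right
      obtain ⟨z, hzr, hz⟩ := not_subset.1 hs
      have hzZ : z ∈ Z := by rw [hZ]; exact mem_sdiff.2 ⟨hrV hzr, hz⟩
      simp only [mem_insert, mem_singleton, not_or] at hz
      have fin : ∀ p q, p ≠ q → p ∈ r → q ∈ r → z ≠ p → z ≠ q →
          r ∈ (th R p q Z).image fun z => {p, q, z} := by
        intro p q hpq hp hq hzp hzq
        have hre : ({p, q, z} : Finset α) = r := by
          apply eq_of_subset_of_card_le
          · intro u; simp only [mem_insert, mem_singleton]; rintro (rfl | rfl | rfl) <;> assumption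
          · rw [hr3, card_eq_three.2 ⟨p, q, z, hpq, hzp.symm, hzq.symm, rfl⟩]
        exact mem_image.2 ⟨z, mem_th.2 ⟨hzZ, hre ▸ hr⟩, hre⟩
      obtain ⟨z1, z2, z3, z4⟩ := hz
      rcases h1 with h1 | h1 <;> rcases h2 with h2 | h2
      · exact Or.inl (fin a c hac h1 h2 z1 z3)
      · exact Or.inr (Or.inl (fin a d had h1 h2 z1 z4))
      · exact Or.inr (Or.inr (Or.inl (fin b c hbc h1 h2 z2 z3)))
      · exact Or.inr (Or.inr (Or.inr (fin b d hbd h1 h2 z2 z4))))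
  simp only [List.map_cons, List.map_nil, List.sum_cons, List.sum_nil] at this
  have i1 := im a c
  have i2 := im a d
  have i3 := im b c
  have i4 := im b d
  omega

theorem case_d22 (S : Sp V H A B R) (h8 : 8 ≤ V.card) (h10 : V.card ≤ 10) {a b c d : α}
    (hab : a ≠ b) (hA : ∀ t ∈ A, a ∈ t ∧ b ∈ t) (hka : ∀ z, z ≠ a → z ≠ b → ∃ t ∈ A, z ∉ t)
    (h2 : 2 ≤ A.card)
    (hcd : c ≠ d) (hB : ∀ t ∈ B, c ∈ t ∧ d ∈ t) (hkc : ∀ z, z ≠ c → z ≠ d → ∃ t ∈ B, z ∉ t)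
    (h2' : 2 ≤ B.card) : H.card ≤ bd V.card := by
  have r1 := (side2 (K := {a, b}) S (by
    intro i hi
    by_contra hne
    simp only [mem_insert, mem_singleton, not_or] at hne
    obtain ⟨t, ht, hit⟩ := hka i hne.1 hne.2
    exact hit (hi t ht)) hcd hB hkc h2').1
  have r2 := (side2 (K := {c, d}) S.symm (by
    intro i hi
    by_contra hne
    simp only [mem_insert, mem_singleton, not_or] at hne
    obtain ⟨t, ht, hit⟩ := hkc i hne.1 hne.2
    exact hit (hi t ht)) hab hA hka h2).1
  rw [Finset.card_pair hab] at r1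
  rw [Finset.card_pair hcd] at r2
  obtain ⟨e, he⟩ := S.ane
  obtain ⟨f, hf⟩ := S.bne
  have ne : ∀ p ∈ e, ∀ q ∈ f, p ≠ q := by
    rintro p hp q hq rfl
    exact disjoint_left.1 (S.ab e he f hf) hp hq
  have hac := ne a (hA e he).1 c (hB f hf).1
  have had := ne a (hA e he).1 d (hB f hf).2
  have hbc := ne b (hA e he).2 c (hB f hf).1
  have hbd := ne b (hA e he).2 d (hB f hf).2
  have h4 : ({a, b, c, d} : Finset α).card = 4 := by
    rw [card_insert_of_notMem, card_insert_of_notMem, Finset.card_pair hcd] <;>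
      simp [hab, hac, had, hbc, hbd]
  have hsub : ({a, b, c, d} : Finset α) ⊆ V := by
    intro u; simp only [mem_insert, mem_singleton]
    have eV := (S.tri e (S.Asub he)).1
    have fV := (S.tri f (S.Bsub hf)).1
    rintro (rfl | rfl | rfl | rfl)
    · exact eV (hA e he).1
    · exact eV (hA e he).2
    · exact fV (hB f hf).1
    · exact fV (hB f hf).2
  have hZc := card_sdiff_add_card_eq_card hsub
  have hR := d22_R (S.no.mono S.Rsub) (S.tri.mono S.Rsub) hab hcd hac had hbc hbd (by omega) rfl
  have hRs : R.card ≤ (R.filter fun r => c ∉ r ∧ d ∉ r).card + (R.filter fun r => a ∉ r ∧ b ∉ r).card +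
      (R.filter fun r => (a ∈ r ∨ b ∈ r) ∧ (c ∈ r ∨ d ∈ r)).card := by
    have := card_le_list (F := R) [R.filter fun r => c ∉ r ∧ d ∉ r, R.filter fun r => a ∉ r ∧ b ∉ r,
      R.filter fun r => (a ∈ r ∨ b ∈ r) ∧ (c ∈ r ∨ d ∈ r)] (by
        intro r hr
        simp only [List.mem_cons, List.not_mem_nil, or_false, exists_eq_or_imp, exists_eq_left, mem_filter, hr, true_and]
        clear * -
        tauto)
    simp only [List.map_cons, List.map_nil, List.sum_cons, List.sum_nil] at this
    omega
  have p1 := pairs_le S.triA hab S.ane hA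
  have p2 := pairs_le S.triB hcd S.bne hB
  have p3 := S.cardU
  have p4 := S.card
  unfold bd
  split_ifs <;> omega

theorem turan (hT : Tri V H) (hN : NoP4 H) (h8 : 8 ≤ V.card) (h10 : V.card ≤ 10) :
    H.card ≤ bd V.card ∨ ∃ v, (H.filter fun t => v ∉ t).card + 6 ≤ V.card := by
  by_cases hi : ∀ s ∈ H, ∀ t ∈ H, ¬ Disjoint s t
  · by_cases hv : ∃ v, ∀ t ∈ H, v ∈ t
    · obtain ⟨v, hv⟩ := hv
      right
      refine ⟨v, ?_⟩
      rw [filter_eq_empty_iff.2 (fun t ht => not_not.2 (hv t ht)), card_empty]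
      omega
    · push Not at hv
      left
      have := intersecting_bound hT hi hv h8
      unfold bd
      split_ifs <;> omega
  push Not at hi
  obtain ⟨e, he, f, hf, hef⟩ := hi
  have hne : e ≠ f := by
    rintro rfl
    rw [disjoint_self, bot_eq_empty] at hef
    have := (hT e he).2
    rw [hef, card_empty] at this
    omega
  obtain ⟨A, B, R, ane, bne, heq, hc, hab, har, hbr⟩ := structure_split hN he hf hef hne
  have S : Sp V H A B R := ⟨hN, hT, heq, hc, ane, bne, hab, har, hbr⟩
  clear hc hab har hbr heq hef he hf hne
  rcases R.eq_empty_or_nonempty with hR | hR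
  · exact Or.inl (case0 S h8 h10 hR)
  by_cases kB : ∀ v, ∃ t ∈ B, v ∉ t
  · exact Or.inl (case1 S h8 h10 hR kB)
  by_cases kA : ∀ v, ∃ t ∈ A, v ∉ t
  · exact Or.inl (case1 S.symm h8 h10 hR kA)
  push Not at kA kB
  obtain ⟨u, hu⟩ := kA
  obtain ⟨v, hv⟩ := kB
  have cA := kernel_cases S.triA ane hu
  have cB := kernel_cases S.triB bne hv
  rcases cA with ⟨e, rfl⟩ | ⟨a2, x, y, hxy, hA, hkA⟩ | hkA
  · rcases cB with ⟨f, rfl⟩ | ⟨b2, x', y', hxy', hB, hkB⟩ | hkB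
    · exact Or.inl (case_a S h8 h10)
    · exact case_b S h8 h10 hxy' hB hkB b2
    · exact case_c S h8 h10 hv hkB
  · rcases cB with ⟨f, rfl⟩ | ⟨b2, x', y', hxy', hB, hkB⟩ | hkB
    · exact case_b S.symm h8 h10 hxy hA hkA a2
    · exact Or.inl (case_d22 S h8 h10 hxy hA hkA a2 hxy' hB hkB b2)
    · exact Or.inl (case_d12 S h8 h10 hxy hA hkA a2 hv hkB)
  · rcases cB with ⟨f, rfl⟩ | ⟨b2, x', y', hxy', hB, hkB⟩ | hkB
    · exact case_c S.symm h8 h10 hu hkA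
    · exact Or.inl (case_d12 S.symm h8 h10 hxy' hB hkB b2 hu hkA)
    · exact Or.inl (case_d11 S h8 h10 hu hkA hv hkB)

end RP4

namespace RP4
variable {α : Type*} [DecidableEq α]
variable {V : Finset α} {H A B R : Finset (Finset α)}

theorem max8 (hT : Tri V H) (hN : NoP4 H) (h8 : V.card = 8) : H.card ≤ 24 := by
  rcases turan hT hN (by omega) (by omega) with h | ⟨v, hv⟩
  · rw [h8] at h; exact h
  · have h1 := card_filter_add_card_filter_not (s := H) (fun t => v ∈ t)
    by_cases hvV : v ∈ V
    · have := starA (hT.mono (filter_subset (fun t => v ∈ t) H)) (fun t ht => (mem_filter.1 ht).2) hvV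
      rw [h8] at this
      simp [Nat.choose] at this
      omega
    · have : (H.filter fun t => v ∈ t) = ∅ :=
        filter_eq_empty_iff.2 fun t ht hvt => hvV ((hT t ht).1 hvt)
      rw [this, card_empty] at h1
      omega

/-- a family of triples, coloured with at most `k` colours without monochromatic paths -/
structure Col {κ : Type*} [DecidableEq κ] (c : Finset α → κ) (V : Finset α) (F : Finset (Finset α)) (C : Finset κ) :
    Prop where
  tri : Tri V F
  mem : ∀ t ∈ F, c t ∈ C
  no : ∀ y, NoP4 (F.filter fun t => c t = y)

variable {κ : Type*} [DecidableEq κ] {c : Finset α → κ} {F : Finset (Finset α)} {C : Finset κ}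

theorem ram8 (h : Col c V F C) (hV : V.card = 8) (hC : C.card = 2) (hF : 49 ≤ F.card) : False := by
  obtain ⟨y, -, hy⟩ := exists_lt_card_fiber_of_mul_lt_card_of_maps_to (n := 24) h.mem (by omega)
  have := max8 (h.tri.mono (filter_subset (fun t => c t = y) F)) (h.no y) hV
  omega

theorem ram_step (h : Col c V F C) (h8 : 8 ≤ V.card) (h10 : V.card ≤ 10)
    (hF : C.card * bd V.card < F.card) (h6 : V.card ≤ bd V.card + 6) :
    ∃ V' F' C', Col c V' F' C' ∧ V'.card + 1 = V.card ∧ C'.card + 1 = C.card ∧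
      F.card + 6 ≤ F'.card + (V.card - 1).choose 2 + V.card := by
  obtain ⟨y, hyC, hy⟩ := exists_lt_card_fiber_of_mul_lt_card_of_maps_to h.mem hF
  rcases turan (h.tri.mono (filter_subset (fun t => c t = y) F)) (h.no y) h8 h10 with hle | ⟨v, hv⟩
  · omega
  have hvV : v ∈ V := by
    by_contra hvV
    have hall : ((F.filter fun t => c t = y).filter fun t => v ∉ t) = F.filter fun t => c t = y :=
      filter_true_of_mem (fun t ht hvt => hvV ((h.tri t (mem_filter.1 ht).1).1 hvt))
    rw [hall] at hv
    omega
  refine ⟨V.erase v, F.filter (fun t => v ∉ t ∧ c t ≠ y), C.erase y, ⟨?_, ?_, ?_⟩, ?_, ?_, ?_⟩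
  · intro t ht
    obtain ⟨ht, h1, h2⟩ := mem_filter.1 ht
    exact ⟨subset_erase.2 ⟨(h.tri t ht).1, h1⟩, (h.tri t ht).2⟩
  · intro t ht
    obtain ⟨ht, h1, h2⟩ := mem_filter.1 ht
    exact mem_erase.2 ⟨h2, h.mem t ht⟩
  · intro z
    exact (h.no z).mono (filter_subset_filter _ (filter_subset _ _))
  · exact card_erase_add_one hvV
  · exact card_erase_add_one hyC
  · have h1 := starA (h.tri.mono (filter_subset (fun t => v ∈ t) F)) (fun t ht => (mem_filter.1 ht).2) hvV
    have := card_le_list (F := F) [F.filter fun t => v ∈ t, (F.filter fun t => c t = y).filter fun t => v ∉ t,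
      F.filter (fun t => v ∉ t ∧ c t ≠ y)] (by
        intro r hr
        simp only [List.mem_cons, List.not_mem_nil, or_false, exists_eq_or_imp, exists_eq_left, mem_filter, hr, true_and]
        clear * -
        tauto)
    simp only [List.map_cons, List.map_nil, List.sum_cons, List.sum_nil] at this
    omega

theorem ram9 (h : Col c V F C) (hV : V.card = 9) (hC : C.card = 3) (hF : 80 ≤ F.card) : False := by
  obtain ⟨V', F', C', h', h1, h2, h3⟩ := ram_step h (by omega) (by omega) (by rw [hV, hC, bd]; norm_num; omega)
    (by rw [hV, bd]; norm_num)
  rw [hV] at h3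
  have : (9 - 1).choose 2 = 28 := by decide
  exact ram8 h' (by omega) (by omega) (by omega)

theorem ram10 (h : Col c V F C) (hV : V.card = 10) (hC : C.card = 4) (hF : 120 ≤ F.card) : False := by
  obtain ⟨V', F', C', h', h1, h2, h3⟩ := ram_step h (by omega) (by omega) (by rw [hV, hC, bd]; norm_num; omega)
    (by rw [hV, bd]; norm_num)
  rw [hV] at h3
  have : (10 - 1).choose 2 = 36 := by decide
  exact ram9 h' (by omega) (by omega) (by omega)

theorem col_of {n r : ℕ} (c : Finset (Fin n) → Fin r) (hc : ¬ HasMonoP4 c) :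
    Col c univ (powersetCard 3 (univ : Finset (Fin n))) univ := by
  refine ⟨fun t ht => mem_powersetCard.1 ht, fun _ _ => mem_univ _, ?_⟩
  intro y a0 h0 a1 h1 a2 h2 a3 h3 d01 d12 d23 d02 d03 d13
  rw [mem_filter, mem_powersetCard] at h0 h1 h2 h3
  rw [not_disjoint_iff_nonempty_inter] at d01 d12 d23
  rw [disjoint_iff_inter_eq_empty] at d02 d03 d13
  exact hc ⟨a0, a1, a2, a3, h0.1.2, h1.1.2, h2.1.2, h3.1.2, ⟨d01, d12, d23, d02, d03, d13⟩,
    h0.2.trans h1.2.symm, h1.2.trans h2.2.symm, h2.2.trans h3.2.symm⟩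

theorem upper (r : ℕ) (hr1 : 1 ≤ r) (hr4 : r ≤ 4) (c : Finset (Fin (r + 6)) → Fin r) : HasMonoP4 c := by
  by_contra hc
  have h := col_of c hc
  have hF : (powersetCard 3 (univ : Finset (Fin (r + 6)))).card = (r + 6).choose 3 := by
    rw [card_powersetCard, card_univ, Fintype.card_fin]
  have hV : (univ : Finset (Fin (r + 6))).card = r + 6 := by rw [card_univ, Fintype.card_fin]
  have hC : (univ : Finset (Fin r)).card = r := by rw [card_univ, Fintype.card_fin]
  obtain rfl | rfl | rfl | rfl : r = 1 ∨ r = 2 ∨ r = 3 ∨ r = 4 := by omega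
  · apply hc
    obtain ⟨p1, p2, p3, p4, p5, p6⟩ := zE_path 0
    rw [not_disjoint_iff_nonempty_inter] at p1 p2 p3
    rw [disjoint_iff_inter_eq_empty] at p4 p5 p6
    exact ⟨zE (0, 0), zE (0, 1), zE (0, 2), zE (0, 3), zE_card _, zE_card _, zE_card _, zE_card _,
      ⟨p1, p2, p3, p4, p5, p6⟩, Subsingleton.elim _ _, Subsingleton.elim _ _, Subsingleton.elim _ _⟩
  · exact ram8 h hV hC (by rw [hF]; decide)
  · exact ram9 h hV hC (by rw [hF]; decide)
  · exact ram10 h hV hC (by rw [hF]; decide)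

theorem lower (r : ℕ) (hr1 : 1 ≤ r) (n : ℕ) (hn : n < r + 6) :
    ∃ c : Finset (Fin n) → Fin r, ¬ HasMonoP4 c := by
  refine ⟨fun t => if h : t.Nonempty then ⟨min (t.min' h).val (r - 1), by omega⟩ else ⟨r - 1, by omega⟩, ?_⟩
  rintro ⟨a0, a1, a2, a3, c0, c1, c2, c3, ⟨d01, d12, d23, d02, d03, d13⟩, e1, e2, e3⟩
  have n0 : a0.Nonempty := card_pos.1 (by omega)
  have n1 : a1.Nonempty := card_pos.1 (by omega)
  have n2 : a2.Nonempty := card_pos.1 (by omega)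
  have n3 : a3.Nonempty := card_pos.1 (by omega)
  simp only [dif_pos n0, dif_pos n1, dif_pos n2, dif_pos n3, Fin.mk.injEq] at e1 e2 e3
  by_cases hlt : (a0.min' n0).val < r - 1
  · have : a0.min' n0 = a2.min' n2 := by ext; omega
    have h1 := min'_mem a0 n0
    rw [this] at h1
    have := mem_inter.2 ⟨h1, min'_mem a2 n2⟩
    rw [d02] at this
    simp at this
  · have big : ∀ a : Finset (Fin n), ∀ h : a.Nonempty, r - 1 ≤ (a.min' h).val → ∀ x ∈ a, r - 1 ≤ x.val := by
      intro a h h1 x hx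
      exact h1.trans (Fin.le_def.1 (min'_le a x hx))
    have b0 := big a0 n0 (by omega)
    have b2 := big a2 n2 (by omega)
    have b3 := big a3 n3 (by omega)
    have hsub : (a0 ∪ (a2 ∪ a3)).image Fin.val ⊆ Ico (r - 1) n := by
      intro x hx
      obtain ⟨z, hz, rfl⟩ := mem_image.1 hx
      rw [mem_Ico]
      refine ⟨?_, z.2⟩
      rw [mem_union, mem_union] at hz
      rcases hz with hz | hz | hz
      · exact b0 z hz
      · exact b2 z hz
      · exact b3 z hz
    have hc := card_le_card hsub
    rw [card_image_of_injective _ Fin.val_injective, Nat.card_Ico, card_union_of_disjoint, c0] at hc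
    · have h4 : 3 < (a2 ∪ a3).card := by
        by_contra hle
        have h2 : a2 = a2 ∪ a3 := eq_of_subset_of_card_le subset_union_left (by omega)
        have h3 : a3 = a2 ∪ a3 := eq_of_subset_of_card_le subset_union_right (by omega)
        have : a2 = a3 := h2.trans h3.symm
        rw [this, d13] at d12
        simp at d12
      omega
    · rw [disjoint_union_right]
      exact ⟨disjoint_iff_inter_eq_empty.2 d02, disjoint_iff_inter_eq_empty.2 d03⟩

end RP4

/-- For `1 ≤ r ≤ 4`, the Ramsey number `R(𝒫₄; r)` equals `r + 6`: every
`r`-coloring of `K⁽³⁾_{r+6}` has a monochromatic minimal 4-path, and for each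
`n < r + 6` some `r`-coloring of `K⁽³⁾ₙ` has no monochromatic minimal 4-path. -/
theorem ramsey_P4 (r : ℕ) (hr1 : 1 ≤ r) (hr4 : r ≤ 4) :
    (∀ c : Finset (Fin (r + 6)) → Fin r, HasMonoP4 c) ∧
    (∀ n : ℕ, n < r + 6 → ∃ c : Finset (Fin n) → Fin r, ¬HasMonoP4 c) := by
  exact ⟨RP4.upper r hr1 hr4, RP4.lower r hr1⟩
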